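/- arXiv:2001.07598 — 2 statements merged into one kernel-verified Lean document; each statement's English description precedes it below -/
import Mathlib

section
/- Let y = (y_α)_{α∈ℕⁿ} be a real multisequence and g ∈ ℝ[x₁,…,xₙ] such that the moment matrices M_d(y) are positive semidefinite and the localizing matrices M_d(g·y) are positive semidefinite for all d ∈ ℕ. If there exist constants c, M > 0 such that |y_α| ≤ c·M^{|α|} for all α ∈ ℕⁿ, then y has a unique representing Borel measure φ, φ is supported on [−M, M]ⁿ, and supp(φ) ⊆ [−M, M]ⁿ ∩ {x ∈ ℝⁿ : g(x) ≥ 0}. -/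
open MeasureTheory MvPolynomial Filter Topology
open scoped ENNReal

noncomputable section

/-- the monomial `x^α` -/
def monom {n : ℕ} (α : Fin n → ℕ) (x : EuclideanSpace ℝ (Fin n)) : ℝ := ∏ i, x i ^ α i

/-- `|α| = α₁ + ⋯ + αₙ` -/
def degSum {n : ℕ} (α : Fin n → ℕ) : ℕ := ∑ i, α i

/-- evaluation of a polynomial at a point of Euclidean space -/
def pev {n : ℕ} (p : MvPolynomial (Fin n) ℝ) (x : EuclideanSpace ℝ (Fin n)) : ℝ :=
  eval (fun i => x i) p

/-- the Riesz functional `L_y` of a multisequence `y` -/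
def riesz {n : ℕ} (y : (Fin n → ℕ) → ℝ) (p : MvPolynomial (Fin n) ℝ) : ℝ :=
  ∑ m ∈ p.support, p.coeff m * y (fun i => m i)

/-- positive semidefiniteness of the localizing matrix `M(g·y)` with rows and columns
indexed by monomials of degree `≤ k` (equivalent quadratic-form formulation:
`0 ≤ L_y(g·p²)` for every polynomial `p` of degree `≤ k`). -/
def locPSD {n : ℕ} (y : (Fin n → ℕ) → ℝ) (g : MvPolynomial (Fin n) ℝ) (k : ℕ) : Prop :=
  ∀ p : MvPolynomial (Fin n) ℝ, p.totalDegree ≤ k → 0 ≤ riesz y (g * p ^ 2)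

/-- the localizing matrix `M(g·y)` with rows/columns of degree `≤ k` vanishes
(entrywise, extended bilinearly). -/
def locZero {n : ℕ} (y : (Fin n → ℕ) → ℝ) (g : MvPolynomial (Fin n) ℝ) (k : ℕ) : Prop :=
  ∀ p q : MvPolynomial (Fin n) ℝ, p.totalDegree ≤ k → q.totalDegree ≤ k →
    riesz y (g * (p * q)) = 0

/-- a Borel measure `μ` represents the multisequence `y` if all monomials are
`μ`-integrable with `∫ x^α dμ = y_α`. -/
def Represents {n : ℕ} (μ : Measure (EuclideanSpace ℝ (Fin n))) (y : (Fin n → ℕ) → ℝ) : Prop :=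
  ∀ α : Fin n → ℕ, Integrable (monom α) μ ∧ ∫ x, monom α x ∂μ = y α

/-- `‖∇g(x)‖²` -/
def gradSq {n : ℕ} (p : MvPolynomial (Fin n) ℝ) (x : EuclideanSpace ℝ (Fin n)) : ℝ :=
  ∑ i, (pev (pderiv i p) x) ^ 2

/-- `‖∇g(x)‖` -/
def gradNorm {n : ℕ} (p : MvPolynomial (Fin n) ℝ) (x : EuclideanSpace ℝ (Fin n)) : ℝ :=
  Real.sqrt (gradSq p x)

/-- `q(x) = ⟨x, ∇g(x)⟩` -/
def xGrad {n : ℕ} (p : MvPolynomial (Fin n) ℝ) (x : EuclideanSpace ℝ (Fin n)) : ℝ :=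
  ∑ i, x i * pev (pderiv i p) x

/-- the basic closed semi-algebraic set `Ω = {x | g_j(x) ≤ b_j, j = 1,…,m}` -/
def Om {n m : ℕ} (g : Fin m → MvPolynomial (Fin n) ℝ) (b : Fin m → ℝ) :
    Set (EuclideanSpace ℝ (Fin n)) :=
  {x | ∀ j, pev (g j) x ≤ b j}

/-- `Ω_j = {x ∈ Ω | g_j(x) = b_j}` -/
def OmJ {n m : ℕ} (g : Fin m → MvPolynomial (Fin n) ℝ) (b : Fin m → ℝ) (j : Fin m) :
    Set (EuclideanSpace ℝ (Fin n)) :=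
  {x | x ∈ Om g b ∧ pev (g j) x = b j}

/-- the open box `B = (−1,1)ⁿ` -/
def Box (n : ℕ) : Set (EuclideanSpace ℝ (Fin n)) := {x | ∀ i, |x i| < 1}

/-- the `(n−1)`-dimensional Hausdorff measure on `ℝⁿ` -/
def hsd (n : ℕ) : Measure (EuclideanSpace ℝ (Fin n)) := μH[(n : ℝ) - 1]

/-- `σ_j`: the restriction to `Ω_j` of the `(n−1)`-dimensional Hausdorff measure -/
def sigmaJ {n m : ℕ} (g : Fin m → MvPolynomial (Fin n) ℝ) (b : Fin m → ℝ) (j : Fin m) :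
    Measure (EuclideanSpace ℝ (Fin n)) :=
  (hsd n).restrict (OmJ g b j)

/-- `φ_j`: the measure `dφ_j = ‖∇g_j‖⁻¹ dσ_j` on `Ω_j` -/
def phiJ {n m : ℕ} (g : Fin m → MvPolynomial (Fin n) ℝ) (b : Fin m → ℝ) (j : Fin m) :
    Measure (EuclideanSpace ℝ (Fin n)) :=
  (sigmaJ g b j).withDensity fun x => ENNReal.ofReal (gradNorm (g j) x)⁻¹



namespace MomAux

variable {n : ℕ}

abbrev Fun (n : ℕ) := MvPolynomial (Fin n) ℝ →ₗ[ℝ] ℝ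

/-- nonnegative on squares -/
def Psd (L : Fun n) : Prop := ∀ p, 0 ≤ L (p ^ 2)

/-- exponentially bounded -/
def Bdd (M : ℝ) (L : Fun n) : Prop :=
  ∃ C : ℝ, ∀ m : Fin n →₀ ℕ, |L (monomial m 1)| ≤ C * M ^ m.degree

/-- shifted functional -/
def sh (q : MvPolynomial (Fin n) ℝ) (L : Fun n) : Fun n := L ∘ₗ LinearMap.mulLeft ℝ q

lemma sh_apply (q : MvPolynomial (Fin n) ℝ) (L : Fun n) (p) : sh q L p = L (q * p) := rfl

lemma sh_sq_psd {L : Fun n} (h : Psd L) (q) : Psd (sh (q ^ 2) L) := by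
  intro p
  rw [sh_apply, ← mul_pow]
  exact h _

lemma Bdd.sh {M : ℝ} (hM : 0 < M) {L : Fun n} (h : Bdd M L) (q) : Bdd M (sh q L) := by
  induction q using MvPolynomial.induction_on' with
  | monomial u a =>
    obtain ⟨C, hC⟩ := h
    refine ⟨|a| * C * M ^ u.degree, fun m => ?_⟩
    have : (monomial u a : MvPolynomial (Fin n) ℝ) * monomial m 1 = a • monomial (u + m) 1 := by
      rw [monomial_mul, smul_monomial]; simp
    rw [sh_apply, this, map_smul, smul_eq_mul, abs_mul]
    calc |a| * |L (monomial (u + m) 1)| ≤ |a| * (C * M ^ (u + m).degree) := by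
          gcongr; exact hC _
      _ = _ := by rw [map_add, pow_add]; ring
  | add p q hp hq =>
    obtain ⟨C, hC⟩ := hp
    obtain ⟨D, hD⟩ := hq
    refine ⟨C + D, fun m => ?_⟩
    rw [sh_apply, add_mul, map_add, add_mul]
    exact (abs_add_le _ _).trans (add_le_add (hC m) (hD m))

lemma Psd.cs {L : Fun n} (h : Psd L) (u) : L u ^ 2 ≤ L 1 * L (u ^ 2) := by
  have h1 : 0 ≤ L 1 := by simpa using h 1
  have key : ∀ t : ℝ, 0 ≤ L 1 * (t * t) + (2 * L u) * t + L (u ^ 2) := by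
    intro t
    have e : (u + t • 1) ^ 2 = (t * t) • (1 : MvPolynomial (Fin n) ℝ) + (2 * t) • u + u ^ 2 := by
      simp only [smul_eq_C_mul, map_mul, map_ofNat]
      ring
    have := h (u + t • 1)
    rw [e, map_add, map_add, map_smul, map_smul, smul_eq_mul, smul_eq_mul] at this
    linarith
  have := discrim_le_zero key
  rw [discrim] at this
  nlinarith

lemma Psd.bound {L : Fun n} (h : Psd L) (u) {C R : ℝ} (hR : 0 < R)
    (hb : ∀ k : ℕ, |L (u ^ k)| ≤ C * R ^ k) : |L u| ≤ L 1 * R := by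
  have h1 : 0 ≤ L 1 := by simpa using h 1
  rcases h1.eq_or_lt with h0 | h0
  · have := h.cs u
    rw [← h0, zero_mul] at this
    have : L u = 0 := by nlinarith
    rw [this, ← h0]; simp
  by_contra! hlt
  set r := |L u| / L 1 with hr
  have hrR : R < r := by rw [hr, lt_div_iff₀ h0]; linarith
  have hpow : ∀ k : ℕ, r ^ (2 ^ k) ≤ |L (u ^ (2 ^ k))| / L 1 := by
    intro k
    induction k with
    | zero => simp [hr]
    | succ k ih =>
      rw [pow_succ, pow_mul]
      have hr0 : 0 ≤ r ^ 2 ^ k := by positivity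
      calc (r ^ 2 ^ k) ^ 2 ≤ (|L (u ^ (2 ^ k))| / L 1) ^ 2 := by gcongr
        _ = L (u ^ (2 ^ k)) ^ 2 / (L 1 * L 1) := by rw [div_pow, sq_abs]; ring
        _ ≤ L 1 * L ((u ^ (2 ^ k)) ^ 2) / (L 1 * L 1) := by
          gcongr; exact h.cs _
        _ = L ((u ^ (2 ^ k)) ^ 2) / L 1 := by field_simp
        _ ≤ _ := by rw [← pow_mul]; gcongr; exact le_abs_self _
  have hq : 1 < r / R := by rw [lt_div_iff₀ hR]; linarith
  have htend : Tendsto (fun k : ℕ => (r / R) ^ (2 ^ k)) atTop atTop :=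
    (tendsto_pow_atTop_atTop_of_one_lt hq).comp
      (tendsto_pow_atTop_atTop_of_one_lt (by norm_num))
  obtain ⟨k, hk⟩ := (htend.eventually_gt_atTop (C / L 1)).exists
  have := (hpow k).trans (div_le_div_of_nonneg_right (hb (2 ^ k)) h0.le)
  rw [div_pow, lt_div_iff₀ (by positivity)] at hk
  rw [mul_div_right_comm] at this
  linarith

lemma Psd.bound_monomial {M : ℝ} (hM : 0 < M) {L : Fun n} (h : Psd L) (hB : Bdd M L)
    (m : Fin n →₀ ℕ) : |L (monomial m 1)| ≤ L 1 * M ^ m.degree := by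
  obtain ⟨C, hC⟩ := hB
  refine h.bound (C := C) _ (by positivity) fun k => ?_
  rw [monomial_pow, one_pow]
  refine (hC _).trans (le_of_eq ?_)
  rw [← pow_mul, map_nsmul, smul_eq_mul, mul_comm k]

lemma Psd.bound_X {M : ℝ} (hM : 0 < M) {L : Fun n} (h : Psd L) (hB : Bdd M L) (i : Fin n) :
    |L (X i)| ≤ L 1 * M := by
  have := h.bound_monomial hM hB (Finsupp.single i 1)
  simpa [X] using this

lemma Psd.eq_zero {M : ℝ} (hM : 0 < M) {L : Fun n} (h : Psd L) (hB : Bdd M L) (h0 : L 1 = 0) :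
    L = 0 := by
  apply (basisMonomials (Fin n) ℝ).ext
  intro m
  have := h.bound_monomial hM hB m
  rw [h0, zero_mul] at this
  simpa using abs_nonpos_iff.1 this

/-- `M + ε x_i` preserves positivity. -/
lemma Psd.shift {M : ℝ} (hM : 0 < M) {L : Fun n} (h : Psd L) (hB : Bdd M L) (i : Fin n)
    (e : ℝ) (he : |e| ≤ 1) : Psd (sh (C M + C e * X i) L) := by
  intro p
  have h2 := (sh_sq_psd h p).bound_X hM (hB.sh hM _) i
  have h1 : 0 ≤ L (p ^ 2) := h p
  rw [sh_apply, sh_apply, mul_one] at h2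
  have e1 : (C M + C e * X i) * p ^ 2 = M • p ^ 2 + e • (p ^ 2 * X i) := by
    simp only [smul_eq_C_mul]; ring
  rw [sh_apply, e1, map_add, map_smul, map_smul, smul_eq_mul, smul_eq_mul]
  have : |e * L (p ^ 2 * X i)| ≤ L (p ^ 2) * M := by
    rw [abs_mul]
    nlinarith [abs_nonneg (L (p ^ 2 * X i)), abs_nonneg e]
  linarith [neg_abs_le (e * L (p ^ 2 * X i))]

lemma sh_comm (p q) (L : Fun n) : sh p (sh q L) = sh q (sh p L) := by
  ext m; simp only [LinearMap.coe_comp, Function.comp, sh_apply]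
  ring_nf

lemma sh_smul (a : ℝ) (q) (L : Fun n) : sh q (a • L) = a • sh q L := rfl

lemma Psd.smul {L : Fun n} (h : Psd L) {a : ℝ} (ha : 0 ≤ a) : Psd (a • L) := fun p => by
  simpa using mul_nonneg ha (h p)

lemma Bdd.smul {M : ℝ} {L : Fun n} (h : Bdd M L) (a : ℝ) : Bdd M (a • L) := by
  obtain ⟨D, hD⟩ := h
  refine ⟨|a| * D, fun m => ?_⟩
  rw [LinearMap.smul_apply, smul_eq_mul, abs_mul, mul_assoc]
  gcongr
  exact hD m

/-- functional of a sequence -/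
def fn (z : (Fin n →₀ ℕ) → ℝ) : Fun n := (basisMonomials (Fin n) ℝ).constr ℝ z

lemma fn_monomial (z : (Fin n →₀ ℕ) → ℝ) (m) : fn z (monomial m 1) = z m := by
  have := (basisMonomials (Fin n) ℝ).constr_basis ℝ z m
  simpa [fn] using this

lemma fn_one (z : (Fin n →₀ ℕ) → ℝ) : fn z 1 = z 0 := fn_monomial z 0

lemma fn_apply (z : (Fin n →₀ ℕ) → ℝ) (p) : fn z p = ∑ m ∈ p.support, p.coeff m * z m := by
  conv_lhs => rw [p.as_sum]
  rw [map_sum]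
  refine Finset.sum_congr rfl fun m _ => ?_
  have : (monomial m (coeff m p) : MvPolynomial (Fin n) ℝ) = coeff m p • monomial m 1 := by
    rw [smul_monomial]; simp
  rw [this, map_smul, fn_monomial, smul_eq_mul]

lemma fn_seq (L : Fun n) : fn (fun m => L (monomial m 1)) = L := by
  apply (basisMonomials (Fin n) ℝ).ext
  intro m
  simpa using fn_monomial _ m

lemma fn_continuous (p : MvPolynomial (Fin n) ℝ) : Continuous fun z => fn z p := by
  simp only [fn_apply]
  fun_prop

lemma fn_comb (a b : ℝ) (z w : (Fin n →₀ ℕ) → ℝ) : fn (a • z + b • w) = a • fn z + b • fn w := by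
  simp [fn]

/-- The convex compact set of normalized functionals. -/
def S (M : ℝ) (g : MvPolynomial (Fin n) ℝ) : Set ((Fin n →₀ ℕ) → ℝ) :=
  {z | z 0 = 1 ∧ Psd (fn z) ∧ Psd (sh g (fn z)) ∧ ∀ m, |z m| ≤ M ^ m.degree}

lemma S_convex (M : ℝ) (g : MvPolynomial (Fin n) ℝ) : Convex ℝ (S M g) := by
  rintro z ⟨hz0, hz1, hz2, hz3⟩ w ⟨hw0, hw1, hw2, hw3⟩ a b ha hb hab
  refine ⟨by simp [hz0, hw0, hab], ?_, ?_, fun m => ?_⟩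
  · intro p
    rw [fn_comb]
    have := mul_nonneg ha (hz1 p); have := mul_nonneg hb (hw1 p)
    simp only [LinearMap.add_apply, LinearMap.smul_apply, smul_eq_mul]; linarith
  · intro p
    rw [fn_comb]
    have := mul_nonneg ha (hz2 p); have := mul_nonneg hb (hw2 p)
    simp only [sh_apply, LinearMap.add_apply, LinearMap.smul_apply, smul_eq_mul] at *; linarith
  · simp only [Pi.add_apply, Pi.smul_apply, smul_eq_mul]
    calc |a * z m + b * w m| ≤ |a * z m| + |b * w m| := abs_add_le _ _
      _ = a * |z m| + b * |w m| := by rw [abs_mul, abs_mul, abs_of_nonneg ha, abs_of_nonneg hb]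
      _ ≤ a * M ^ m.degree + b * M ^ m.degree := by gcongr <;> simp [hz3, hw3]
      _ = M ^ m.degree := by rw [← add_mul, hab, one_mul]

lemma S_compact (M : ℝ) (g : MvPolynomial (Fin n) ℝ) : IsCompact (S M g) := by
  have hK : IsCompact (Set.pi Set.univ fun m : Fin n →₀ ℕ =>
      Set.Icc (-(M ^ m.degree)) (M ^ m.degree)) := isCompact_univ_pi fun m => isCompact_Icc
  refine hK.of_isClosed_subset ?_ fun z hz m _ => abs_le.1 (hz.2.2.2 m)
  have : S M g = {z | z 0 = 1} ∩ ({z | ∀ p, 0 ≤ fn z (p ^ 2)} ∩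
      ({z | ∀ p, 0 ≤ fn z (g * p ^ 2)} ∩ {z | ∀ m, |z m| ≤ M ^ m.degree})) := rfl
  rw [this]
  refine (isClosed_eq (continuous_apply 0) continuous_const).inter (.inter ?_ (.inter ?_ ?_))
  · simp only [Set.ofPred_forall]
    exact isClosed_iInter fun p => isClosed_le continuous_const (fn_continuous _)
  · simp only [Set.ofPred_forall]
    exact isClosed_iInter fun p => isClosed_le continuous_const (fn_continuous _)
  · simp only [Set.ofPred_forall]
    exact isClosed_iInter fun m => isClosed_le (continuous_apply m).abs continuous_const

/-- normalization lands in `S` -/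
lemma mem_S {M : ℝ} (hM : 0 < M) {g : MvPolynomial (Fin n) ℝ} {L : Fun n} (h : Psd L)
    (hB : Bdd M L) (hg : Psd (sh g L)) (h1 : 0 < L 1) :
    (fun m => (L 1)⁻¹ * L (monomial m 1)) ∈ S M g := by
  have e : fn (fun m => (L 1)⁻¹ * L (monomial m 1)) = (L 1)⁻¹ • L := fn_seq ((L 1)⁻¹ • L)
  refine ⟨?_, ?_, ?_, fun m => ?_⟩
  · exact inv_mul_cancel₀ h1.ne'
  · rw [e]; exact h.smul (by positivity)
  · rw [e, sh_smul]; exact hg.smul (by positivity)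
  · rw [abs_mul, abs_of_pos (inv_pos.2 h1), inv_mul_le_iff₀ h1]
    exact h.bound_monomial hM hB m

lemma S_bdd {M : ℝ} {g : MvPolynomial (Fin n) ℝ} {z} (hz : z ∈ S M g) : Bdd M (fn z) :=
  ⟨1, fun m => by rw [fn_monomial, one_mul]; exact hz.2.2.2 m⟩

/-- extreme points are multiplicative -/
lemma extreme_mul {M : ℝ} (hM : 0 < M) {g : MvPolynomial (Fin n) ℝ} {z}
    (hz : z ∈ (S M g).extremePoints ℝ) (i : Fin n) (q) :
    fn z (X i * q) = fn z (X i) * fn z q := by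
  obtain ⟨hzS, hext⟩ := mem_extremePoints_iff_left.1 hz
  have hB := S_bdd hzS
  obtain ⟨hz0, hz1, hz2, hz3⟩ := hzS
  set L := fn z with hL
  have hL1 : L 1 = 1 := by rw [hL, fn_one, hz0]
  set a : MvPolynomial (Fin n) ℝ := C M + C 1 * X i with ha
  set b : MvPolynomial (Fin n) ℝ := C M + C (-1) * X i with hb
  have hab : ∀ q, L (a * q) + L (b * q) = 2 * M * L q := by
    intro q
    have : a * q + b * q = (2 * M) • q := by
      simp only [ha, hb, smul_eq_C_mul, map_mul, map_neg, map_one, map_ofNat]; ring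
    rw [← map_add, this, map_smul, smul_eq_mul]
  have pa : Psd (sh a L) := hz1.shift hM hB i 1 (by simp)
  have pb : Psd (sh b L) := hz1.shift hM hB i (-1) (by simp)
  have ga : Psd (sh g (sh a L)) := by
    rw [sh_comm]; exact hz2.shift hM (hB.sh hM _) i 1 (by simp)
  have gb : Psd (sh g (sh b L)) := by
    rw [sh_comm]; exact hz2.shift hM (hB.sh hM _) i (-1) (by simp)
  have Ba : Bdd M (sh a L) := hB.sh hM _
  have Bb : Bdd M (sh b L) := hB.sh hM _
  have main : ∀ q, L (a * q) = L a * L q := by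
    have a1 : sh a L 1 = L a := by rw [sh_apply, mul_one]
    have b1 : sh b L 1 = L b := by rw [sh_apply, mul_one]
    have hs : L a + L b = 2 * M := by simpa [hL1] using hab 1
    have a0 : 0 ≤ L a := by rw [← a1]; simpa using pa 1
    have b0 : 0 ≤ L b := by rw [← b1]; simpa using pb 1
    intro q
    rcases a0.eq_or_lt with h0 | a0
    · have := pa.eq_zero hM Ba (a1.trans h0.symm)
      rw [← sh_apply, this, ← h0]; simp
    rcases b0.eq_or_lt with h0 | b0
    · have := pb.eq_zero hM Bb (b1.trans h0.symm)
      have hq := hab q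
      rw [← sh_apply b, this] at hq
      simp only [LinearMap.zero_apply, add_zero] at hq
      rw [hq, ← hs, ← h0, add_zero]
    have hsa := mem_S hM pa Ba ga (by rwa [a1])
    have hsb := mem_S hM pb Bb gb (by rwa [b1])
    have := hext _ hsa _ hsb ⟨L a / (2 * M), L b / (2 * M), by positivity, by positivity,
      by rw [← add_div, hs, div_self (by positivity)], ?_⟩
    · rw [a1, b1] at *
      have e := fn_seq ((L a)⁻¹ • sh a L)
      have e2 : fn z = (L a)⁻¹ • sh a L := by
        rw [← e, ← this]; rfl
      have e3 := congrArg (fun F : Fun n => F q) e2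
      simp only [LinearMap.smul_apply, smul_eq_mul, sh_apply] at e3
      rw [← hL] at e3
      rw [e3]
      field_simp
    · ext m
      simp only [Pi.add_apply, Pi.smul_apply, smul_eq_mul, a1, b1, sh_apply]
      have := hab (monomial m 1)
      have hzm : L (monomial m 1) = z m := fn_monomial z m
      rw [hzm] at this
      field_simp
      linarith
  have e : ∀ q, L (a * q) = M * L q + L (X i * q) := by
    intro q
    have : a * q = M • q + X i * q := by
      simp only [ha, smul_eq_C_mul, map_one]; ring
    rw [this, map_add, map_smul, smul_eq_mul]
  have h1 := main q
  have h2 := e 1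
  rw [e, show L a = M + L (X i) by simpa [hL1] using h2] at h1
  linarith

lemma extreme_eval {M : ℝ} (hM : 0 < M) {g : MvPolynomial (Fin n) ℝ} {z}
    (hz : z ∈ (S M g).extremePoints ℝ) :
    ∃ x : EuclideanSpace ℝ (Fin n), (∀ i, |x i| ≤ M) ∧ 0 ≤ pev g x ∧ ∀ p, fn z p = pev p x := by
  have hzS := hz.1
  have hL1 : fn z 1 = 1 := by rw [fn_one, hzS.1]
  have hp : ∀ p, fn z p = pev p (WithLp.toLp 2 fun i => fn z (X i)) := by
    intro p
    induction p using MvPolynomial.induction_on with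
    | C a =>
      have : (C a : MvPolynomial (Fin n) ℝ) = a • 1 := by simp [smul_eq_C_mul]
      rw [this, map_smul, hL1]; simp [pev]
    | add p q hp hq => rw [map_add, hp, hq]; simp [pev]
    | mul_X p i hp => rw [mul_comm, extreme_mul hM hz, hp]; simp [pev]
  refine ⟨_, fun i => ?_, ?_, hp⟩
  · have := hzS.2.1.bound_X hM (S_bdd hzS) i
    rw [hL1, one_mul] at this
    exact this
  · rw [← hp]
    simpa [sh_apply] using hzS.2.2.1 1

end MomAux

namespace MomAux

variable {n : ℕ}

lemma pev_continuous (p : MvPolynomial (Fin n) ℝ) : Continuous (pev p) := by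
  unfold pev
  exact (MvPolynomial.continuous_eval p).comp (by fun_prop)

lemma monom_eq (α : Fin n → ℕ) :
    monom α = pev (monomial (Finsupp.equivFunOnFinite.symm α) 1) := by
  funext x
  simp [monom, pev, eval_monomial, Finsupp.prod_fintype]

lemma degSum_eq (m : Fin n →₀ ℕ) : degSum (fun i => m i) = m.degree := by
  simp [degSum, Finsupp.degree_eq_sum]

def box (n : ℕ) (M : ℝ) : Set (EuclideanSpace ℝ (Fin n)) := {x | ∀ i, |x i| ≤ M}

lemma box_compact (M : ℝ) : IsCompact (box n M) := by
  have h : IsCompact (Set.pi Set.univ fun _ : Fin n => Set.Icc (-M) M) :=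
    isCompact_univ_pi fun _ => isCompact_Icc
  have h2 := h.image (PiLp.continuous_toLp 2 (fun _ : Fin n => ℝ))
  convert h2 using 1
  ext x
  constructor
  · intro hx
    exact ⟨x.ofLp, fun i _ => abs_le.1 (hx i), rfl⟩
  · rintro ⟨v, hv, rfl⟩ i
    exact abs_le.2 (hv i trivial)

def KK (M : ℝ) (g : MvPolynomial (Fin n) ℝ) : Set (EuclideanSpace ℝ (Fin n)) :=
  box n M ∩ {x | 0 ≤ pev g x}

lemma KK_compact (M : ℝ) (g : MvPolynomial (Fin n) ℝ) : IsCompact (KK M g) :=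
  (box_compact M).inter_right (isClosed_le continuous_const (pev_continuous g))

/-- polynomials as bounded continuous functions on a compact set -/
def bcf (K : Set (EuclideanSpace ℝ (Fin n))) [CompactSpace K] (p : MvPolynomial (Fin n) ℝ) :
    BoundedContinuousFunction K ℝ :=
  BoundedContinuousFunction.mkOfCompact
    ⟨fun x => pev p x, (pev_continuous p).comp continuous_subtype_val⟩

def mo (K : Set (EuclideanSpace ℝ (Fin n))) [CompactSpace K] (μ : ProbabilityMeasure K) :
    (Fin n →₀ ℕ) → ℝ := fun m => ∫ x, bcf K (monomial m 1) x ∂(μ : Measure K)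

lemma mo_closed (K : Set (EuclideanSpace ℝ (Fin n))) [CompactSpace K] :
    IsClosed (Set.range (mo K)) := by
  refine (isCompact_range ?_).isClosed
  refine continuous_pi fun m => ?_
  exact ProbabilityMeasure.continuous_integral_boundedContinuousFunction _

lemma mo_convex (K : Set (EuclideanSpace ℝ (Fin n))) [CompactSpace K] :
    Convex ℝ (Set.range (mo K)) := by
  rintro _ ⟨μ, rfl⟩ _ ⟨ν, rfl⟩ a b ha hb hab
  have hP : IsProbabilityMeasure
      (ENNReal.ofReal a • (μ : Measure K) + ENNReal.ofReal b • (ν : Measure K)) := by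
    constructor
    simp [← ENNReal.ofReal_add ha hb, hab]
  refine ⟨⟨_, hP⟩, ?_⟩
  funext m
  have hi : ∀ ρ : ProbabilityMeasure K,
      Integrable (bcf K (monomial m 1)) (ρ : Measure K) := fun ρ =>
    BoundedContinuousFunction.integrable _ _
  simp only [mo, ProbabilityMeasure.coe_mk, Pi.add_apply, Pi.smul_apply, smul_eq_mul]
  rw [integral_add_measure ((hi μ).smul_measure ENNReal.ofReal_ne_top)
    ((hi ν).smul_measure ENNReal.ofReal_ne_top), integral_smul_measure, integral_smul_measure,
    ENNReal.toReal_ofReal ha, ENNReal.toReal_ofReal hb, smul_eq_mul, smul_eq_mul]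

lemma exists_prob {M : ℝ} (hM : 0 < M) {g : MvPolynomial (Fin n) ℝ} [CompactSpace (KK M g)] {z}
    (hz : z ∈ S M g) : ∃ μ, mo (KK M g) μ = z := by
  have hz' := hz
  rw [← closure_convexHull_extremePoints (S_compact M g) (S_convex M g)] at hz'
  have hsub : (S M g).extremePoints ℝ ⊆ Set.range (mo (KK M g)) := by
    intro w hw
    obtain ⟨x, hx1, hx2, hx⟩ := extreme_eval hM hw
    refine ⟨⟨Measure.dirac ⟨x, hx1, hx2⟩, inferInstance⟩, ?_⟩
    funext m
    rw [← fn_monomial w m, hx]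
    simp [mo, bcf]
  exact closure_minimal (convexHull_min hsub (mo_convex _)) (mo_closed _) hz'

lemma exists_measure {M : ℝ} (hM : 0 < M) {g : MvPolynomial (Fin n) ℝ} {L : Fun n} (h : Psd L)
    (hB : Bdd M L) (hg : Psd (sh g L)) :
    ∃ φ : Measure (EuclideanSpace ℝ (Fin n)), φ (KK M g)ᶜ = 0 ∧
      ∀ m, Integrable (pev (monomial m 1)) φ ∧ ∫ x, pev (monomial m 1) x ∂φ = L (monomial m 1) := by
  have h1 : 0 ≤ L 1 := by simpa using h 1
  rcases h1.eq_or_lt with h0 | h0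
  · refine ⟨0, by simp, fun m => ⟨by simp, ?_⟩⟩
    rw [h.eq_zero hM hB h0.symm]; simp
  have : CompactSpace (KK M g) := isCompact_iff_compactSpace.1 (KK_compact M g)
  obtain ⟨μ, hμ⟩ := exists_prob hM (mem_S hM h hB hg h0)
  have hmeas : MeasurableSet (KK M g) := (KK_compact M g).isClosed.measurableSet
  have hemb := MeasurableEmbedding.subtype_coe hmeas
  refine ⟨ENNReal.ofReal (L 1) • (μ : Measure (KK M g)).map Subtype.val, ?_, fun m => ⟨?_, ?_⟩⟩
  · rw [Measure.smul_apply, Measure.map_apply measurable_subtype_coe hmeas.compl]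
    simp
  · refine Integrable.smul_measure ?_ ENNReal.ofReal_ne_top
    rw [hemb.integrable_map_iff]
    exact BoundedContinuousFunction.integrable (μ : Measure (KK M g)) (bcf (KK M g) (monomial m 1))
  · rw [integral_smul_measure, hemb.integral_map, ENNReal.toReal_ofReal h1, smul_eq_mul]
    have := congrFun hμ m
    simp only [mo] at this
    change L 1 * (∫ x, bcf (KK M g) (monomial m 1) x ∂(μ : Measure (KK M g))) = _
    rw [this]
    field_simp

/-- a measure with exponentially bounded moments lives on the box -/
lemma supp_box {c M : ℝ} (hM : 0 < M) {y : (Fin n → ℕ) → ℝ}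
    (hbound : ∀ α : Fin n → ℕ, |y α| ≤ c * M ^ degSum α)
    {ψ : Measure (EuclideanSpace ℝ (Fin n))} (hψ : Represents ψ y) : ψ (box n M)ᶜ = 0 := by
  have hmono : ∀ i k (x : EuclideanSpace ℝ (Fin n)), monom (Pi.single i k) x = x i ^ k := by
    intro i k x
    unfold monom
    rw [Finset.prod_eq_single i]
    · simp
    · intro j _ hj; simp [hj]
    · simp
  have hdeg : ∀ (i : Fin n) k, degSum (Pi.single i k) = k := by
    intro i k
    simp [degSum]
  have key : ∀ (i : Fin n) (R : ℝ), M < R → ψ {x | R ≤ |x i|} = 0 := by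
    intro i R hR
    have hR0 : 0 < R := hM.trans hR
    have hle : ∀ k : ℕ, ψ {x | R ≤ |x i|} ≤ ENNReal.ofReal (c * ((M / R) ^ 2) ^ k) := by
      intro k
      obtain ⟨hi, he⟩ := hψ (Pi.single i (2 * k))
      have hpos : ∀ x : EuclideanSpace ℝ (Fin n), 0 ≤ monom (Pi.single i (2 * k)) x := by
        intro x; rw [hmono, pow_mul]; positivity
      have hb := (le_abs_self _).trans (hbound (Pi.single i (2 * k)))
      rw [hdeg] at hb
      have h1 : ENNReal.ofReal (R ^ (2 * k)) * ψ {x | R ≤ |x i|} ≤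
          ∫⁻ x, ENNReal.ofReal (monom (Pi.single i (2 * k)) x) ∂ψ := by
        refine le_trans ?_ (mul_meas_ge_le_lintegral₀ hi.1.aemeasurable.ennreal_ofReal
          (ENNReal.ofReal (R ^ (2 * k))))
        refine mul_le_mul' le_rfl (measure_mono fun x (hx : R ≤ |x i|) => ?_)
        change ENNReal.ofReal (R ^ (2 * k)) ≤ ENNReal.ofReal (monom (Pi.single i (2 * k)) x)
        apply ENNReal.ofReal_le_ofReal
        rw [hmono, pow_mul, pow_mul, ← sq_abs (x i)]
        gcongr
      rw [← ofReal_integral_eq_lintegral_ofReal hi (ae_of_all _ hpos), he] at h1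
      have h2 := h1.trans (ENNReal.ofReal_le_ofReal hb)
      have hRk : 0 < R ^ (2 * k) := by positivity
      rw [mul_comm, ← ENNReal.le_div_iff_mul_le (by simp [hRk]) (by simp),
        ← ENNReal.ofReal_div_of_pos hRk] at h2
      convert h2 using 2
      rw [← pow_mul, div_pow, mul_div_assoc]
    have hlim : Tendsto (fun k : ℕ => ENNReal.ofReal (c * ((M / R) ^ 2) ^ k)) atTop (𝓝 0) := by
      rw [← ENNReal.ofReal_zero]
      refine ENNReal.tendsto_ofReal ?_
      have : Tendsto (fun k : ℕ => ((M / R) ^ 2) ^ k) atTop (𝓝 0) := by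
        apply tendsto_pow_atTop_nhds_zero_of_lt_one (by positivity)
        have : M / R < 1 := (div_lt_one hR0).2 hR
        have : 0 < M / R := by positivity
        nlinarith
      simpa using this.const_mul c
    exact le_antisymm (ge_of_tendsto' hlim hle) zero_le
  have hsub : (box n M)ᶜ ⊆ ⋃ i : Fin n, ⋃ k : ℕ, {x | M + 1 / ((k : ℝ) + 1) ≤ |x i|} := by
    intro x hx
    simp only [box, Set.mem_compl_iff, Set.mem_ofPred_eq, not_forall, not_le] at hx
    obtain ⟨i, hi⟩ := hx
    obtain ⟨k, hk⟩ := exists_nat_one_div_lt (sub_pos.2 hi)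
    simp only [Set.mem_iUnion, Set.mem_ofPred_eq]
    exact ⟨i, k, by linarith⟩
  refine measure_mono_null hsub ?_
  rw [measure_iUnion_null_iff]
  intro i
  rw [measure_iUnion_null_iff]
  intro k
  exact key i _ (by have : 0 < 1 / ((k : ℝ) + 1) := by positivity
                    linarith)

lemma integral_pev {μ ν : Measure (EuclideanSpace ℝ (Fin n))} {y : (Fin n → ℕ) → ℝ}
    (hμ : Represents μ y) (hν : Represents ν y) (p : MvPolynomial (Fin n) ℝ) :
    Integrable (pev p) μ ∧ Integrable (pev p) ν ∧ ∫ x, pev p x ∂μ = ∫ x, pev p x ∂ν := by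
  induction p using MvPolynomial.induction_on' with
  | monomial u a =>
    have : pev (monomial u a) = fun x => a * monom (fun i => u i) x := by
      funext x
      simp [monom, pev, eval_monomial, Finsupp.prod_fintype]
    rw [this]
    refine ⟨(hμ _).1.const_mul a, (hν _).1.const_mul a, ?_⟩
    rw [integral_const_mul, integral_const_mul, (hμ _).2, (hν _).2]
  | add p q hp hq =>
    have : pev (p + q) = fun x => pev p x + pev q x := by
      funext x; simp [pev]
    rw [this]
    refine ⟨hp.1.add hq.1, hp.2.1.add hq.2.1, ?_⟩
    rw [integral_add hp.1 hq.1, integral_add hp.2.1 hq.2.1, hp.2.2, hq.2.2]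

lemma finite_of_represents {μ : Measure (EuclideanSpace ℝ (Fin n))} {y : (Fin n → ℕ) → ℝ}
    (hμ : Represents μ y) : IsFiniteMeasure μ := by
  have h := (hμ 0).1
  have : (monom 0 : EuclideanSpace ℝ (Fin n) → ℝ) = fun _ => 1 := by funext x; simp [monom]
  rw [this, integrable_const_iff] at h
  simpa using h

/-- the algebra of polynomial functions -/
def polyAlg (K : Set (EuclideanSpace ℝ (Fin n))) [CompactSpace K] :
    StarSubalgebra ℝ (BoundedContinuousFunction K ℝ) where
  carrier := Set.range (bcf K)
  mul_mem' := by
    rintro _ _ ⟨p, rfl⟩ ⟨q, rfl⟩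
    exact ⟨p * q, by ext x; simp [bcf, pev]⟩
  add_mem' := by
    rintro _ _ ⟨p, rfl⟩ ⟨q, rfl⟩
    exact ⟨p + q, by ext x; simp [bcf, pev]⟩
  algebraMap_mem' r := ⟨C r, by ext x; simp [bcf, pev]⟩
  star_mem' := by
    rintro _ ⟨p, rfl⟩
    exact ⟨p, by ext x; simp⟩

lemma unique_box {M : ℝ} {μ ν : Measure (EuclideanSpace ℝ (Fin n))} {y : (Fin n → ℕ) → ℝ}
    (hμ : Represents μ y) (hν : Represents ν y) (hμ0 : μ (box n M)ᶜ = 0)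
    (hν0 : ν (box n M)ᶜ = 0) : μ = ν := by
  have := finite_of_represents hμ
  have := finite_of_represents hν
  have hmeas : MeasurableSet (box n M) := (box_compact M).isClosed.measurableSet
  have hemb := MeasurableEmbedding.subtype_coe hmeas
  have hc : CompactSpace (box n M) := isCompact_iff_compactSpace.1 (box_compact M)
  have e : ∀ ρ : Measure (EuclideanSpace ℝ (Fin n)), ρ (box n M)ᶜ = 0 →
      (ρ.comap (Subtype.val : box n M → _)).map Subtype.val = ρ := by
    intro ρ hρ
    rw [map_comap_subtype_coe hmeas, Measure.restrict_eq_self_of_ae_mem]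
    exact hρ
  have fin : ∀ ρ : Measure (EuclideanSpace ℝ (Fin n)), IsFiniteMeasure ρ →
      IsFiniteMeasure (ρ.comap (Subtype.val : box n M → _)) := by
    intro ρ hρ
    constructor
    rw [hemb.comap_apply]
    exact measure_lt_top _ _
  have := fin μ inferInstance
  have := fin ν inferInstance
  have : PolishSpace (box n M) := (box_compact M).isClosed.polishSpace
  rw [← e μ hμ0, ← e ν hν0]
  congr 1
  refine ext_of_forall_mem_subalgebra_integral_eq_of_polish (𝕜 := ℝ) (A := polyAlg (box n M))
    ?_ ?_
  · intro a b hab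
    have : ∃ i, a.1 i ≠ b.1 i := by
      by_contra! hcon
      exact hab (Subtype.ext (PiLp.ext hcon))
    obtain ⟨i, hi⟩ := this
    refine ⟨_, ⟨BoundedContinuousFunction.toContinuousMapStarₐ ℝ (bcf (box n M) (X i)),
      ⟨_, ⟨X i, rfl⟩, rfl⟩, rfl⟩, ?_⟩
    simpa [bcf, pev] using hi
  · rintro _ ⟨p, rfl⟩
    obtain ⟨-, -, h⟩ := integral_pev hμ hν p
    rw [← e μ hμ0, ← e ν hν0, hemb.integral_map, hemb.integral_map] at h
    exact h

end MomAux

/-- If all moment matrices `M_d(y)` and all localizing matrices `M_d(g·y)`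
are positive semidefinite and `|y_α| ≤ c·M^{|α|}`, then `y` has a unique representing Borel
measure `φ`, `φ` is supported on `[−M,M]ⁿ`, and
`supp(φ) ⊆ [−M,M]ⁿ ∩ {x | g(x) ≥ 0}`. -/
theorem statement0 {n : ℕ} (y : (Fin n → ℕ) → ℝ) (g : MvPolynomial (Fin n) ℝ)
    (hmom : ∀ d : ℕ, locPSD y 1 d)
    (hloc : ∀ d : ℕ, locPSD y g d)
    (c M : ℝ) (hc : 0 < c) (hM : 0 < M)
    (hbound : ∀ α : Fin n → ℕ, |y α| ≤ c * M ^ degSum α) :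
    ∃ φ : Measure (EuclideanSpace ℝ (Fin n)),
      Represents φ y ∧
      (∀ ψ : Measure (EuclideanSpace ℝ (Fin n)), Represents ψ y → ψ = φ) ∧
      φ {x | ∀ i, |x i| ≤ M}ᶜ = 0 ∧
      φ ({x | ∀ i, |x i| ≤ M} ∩ {x | 0 ≤ pev g x})ᶜ = 0 := by
  open MomAux in
  set z : (Fin n →₀ ℕ) → ℝ := fun m => y (fun i => m i) with hz
  have hr : ∀ p, riesz y p = fn z p := fun p => (fn_apply z p).symm
  have hP : Psd (fn z) := fun p => by
    have := hmom _ p le_rfl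
    rwa [hr, one_mul] at this
  have hG : Psd (sh g (fn z)) := fun p => by
    have := hloc _ p le_rfl
    rwa [hr] at this
  have hB : Bdd M (fn z) := ⟨c, fun m => by
    rw [fn_monomial, ← degSum_eq]; exact hbound _⟩
  obtain ⟨φ, hφ0, hφ⟩ := exists_measure hM hP hB hG
  have hR : Represents φ y := by
    intro α
    rw [monom_eq]
    refine ⟨(hφ _).1, (hφ _).2.trans ?_⟩
    rw [fn_monomial]
    rfl
  have hbox : φ (box n M)ᶜ = 0 := supp_box hM hbound hR
  exact ⟨φ, hR, fun ψ hψ => unique_box hψ hR (supp_box hM hbound hψ) hbox, hbox, hφ0⟩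
end
end

section
/- (Multivariate Carleman condition.) Let y = (y_α)_{α∈ℕⁿ} be a real multisequence such that the moment matrix M_d(y) is positive semidefinite for every d ∈ ℕ, and suppose Σ_{k=1}^∞ L_y(x_i^{2k})^{−1/(2k)} = +∞ for every i = 1,…,n. Then y has a representing Borel measure on ℝⁿ, and this measure is moment determinate (it is the unique measure having the moments y). -/
open MeasureTheory MvPolynomial Filter Topology
open scoped ENNReal

noncomputable section

lemma carl_aux (c : ℕ → ℝ) (N : ℕ) :
    ∑ k ∈ Finset.range N, (∑ j ∈ Finset.range (k+1), ((j:ℝ)+1) * c j) / (((k:ℝ)+1)*((k:ℝ)+2))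
      + (∑ j ∈ Finset.range N, ((j:ℝ)+1) * c j) / ((N:ℝ)+1) = ∑ j ∈ Finset.range N, c j := by
  induction N with
  | zero => simp
  | succ N ih =>
    rw [Finset.sum_range_succ, Finset.sum_range_succ (f := c), ← ih]
    rw [Finset.sum_range_succ (f := fun j : ℕ => ((j:ℝ)+1) * c j)]
    set T := ∑ j ∈ Finset.range N, ((j:ℝ)+1) * c j
    push_cast
    field_simp
    ring

lemma carl_prod (k : ℕ) :
    ∏ j ∈ Finset.range (k+1), (((j:ℝ)+2)^(j+1) / ((j:ℝ)+1)^j) = ((k:ℝ)+2)^(k+1) := by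
  induction k with
  | zero => simp
  | succ k ih =>
    rw [Finset.prod_range_succ, ih]
    push_cast
    have h1 : ((k:ℝ)+1+1) = (k:ℝ)+2 := by ring
    rw [h1]
    have : ((k:ℝ)+2)^(k+1) ≠ 0 := by positivity
    field_simp

lemma carl_w (j : ℕ) : (((j:ℝ)+2)^(j+1) / ((j:ℝ)+1)^j) ≤ Real.exp 1 * ((j:ℝ)+1) := by
  have h0 : (0:ℝ) < (j:ℝ)+1 := by positivity
  have h1 : ((j:ℝ)+2) = ((j:ℝ)+1) * (1 + 1/((j:ℝ)+1)) := by field_simp; ring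
  have h2 : (1 + 1/((j:ℝ)+1))^(j+1) ≤ Real.exp 1 := by
    have h3 : 1 + 1/((j:ℝ)+1) ≤ Real.exp (1/((j:ℝ)+1)) := by
      have := Real.add_one_le_exp (1/((j:ℝ)+1)); linarith
    calc (1 + 1/((j:ℝ)+1))^(j+1) ≤ (Real.exp (1/((j:ℝ)+1)))^(j+1) := by gcongr
      _ = Real.exp 1 := by
        rw [← Real.exp_nat_mul]; congr 1; push_cast; field_simp
  rw [div_le_iff₀ (by positivity), h1, mul_pow]
  calc ((j:ℝ)+1)^(j+1) * (1 + 1/((j:ℝ)+1))^(j+1) ≤ ((j:ℝ)+1)^(j+1) * Real.exp 1 := by gcongr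
    _ = _ := by ring

/-- Carleman's inequality (qualitative form). -/
lemma carleman_summable (c : ℕ → ℝ) (hc : ∀ k, 0 ≤ c k) (hs : Summable c) :
    Summable (fun k : ℕ => (∏ j ∈ Finset.range (k+1), c j) ^ ((1:ℝ)/((k:ℝ)+1))) := by
  have key : ∀ k : ℕ, (∏ j ∈ Finset.range (k+1), c j) ^ ((1:ℝ)/((k:ℝ)+1)) ≤
      Real.exp 1 * ((∑ j ∈ Finset.range (k+1), ((j:ℝ)+1) * c j) / (((k:ℝ)+1)*((k:ℝ)+2))) := by
    intro k
    set w : ℕ → ℝ := fun j => (((j:ℝ)+2)^(j+1) / ((j:ℝ)+1)^j) with hw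
    have hw0 : ∀ j, 0 ≤ w j := fun j => by simp only [hw]; positivity
    have am := Real.geom_mean_le_arith_mean_weighted (Finset.range (k+1))
      (fun _ => (1:ℝ)/((k:ℝ)+1)) (fun j => c j * w j) (fun _ _ => by positivity)
      (by simp; field_simp) (fun j _ => mul_nonneg (hc j) (hw0 j))
    rw [Real.finsetProd_rpow _ _ (fun j _ => mul_nonneg (hc j) (hw0 j)),
      Finset.prod_mul_distrib, Real.mul_rpow (Finset.prod_nonneg fun j _ => hc j)
        (Finset.prod_nonneg fun j _ => hw0 j), carl_prod k] at am
    have h4 : (((k:ℝ)+2)^(k+1)) ^ ((1:ℝ)/((k:ℝ)+1)) = (k:ℝ)+2 := by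
      have h5 : ((k:ℝ)+1) = ((k+1 : ℕ):ℝ) := by push_cast; ring
      rw [h5, one_div]
      exact Real.pow_rpow_inv_natCast (by positivity) (by omega)
    rw [h4, ← Finset.mul_sum] at am
    have h6 : ∑ j ∈ Finset.range (k+1), c j * w j ≤
        Real.exp 1 * ∑ j ∈ Finset.range (k+1), ((j:ℝ)+1) * c j := by
      rw [Finset.mul_sum]
      refine Finset.sum_le_sum fun j _ => ?_
      have := mul_le_mul_of_nonneg_left (carl_w j) (hc j)
      calc c j * w j ≤ c j * (Real.exp 1 * ((j:ℝ)+1)) := this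
        _ = _ := by ring
    have h7 : (0:ℝ) < (k:ℝ)+2 := by positivity
    have h8 : (0:ℝ) < (k:ℝ)+1 := by positivity
    rw [← mul_div_assoc, le_div_iff₀ (by positivity)]
    calc _ = ((k:ℝ)+1) * ((∏ j ∈ Finset.range (k+1), c j) ^ ((1:ℝ)/((k:ℝ)+1)) * ((k:ℝ)+2)) := by ring
      _ ≤ ((k:ℝ)+1) * (1 / ((k:ℝ)+1) * ∑ j ∈ Finset.range (k+1), c j * w j) := by gcongr
      _ = ∑ j ∈ Finset.range (k+1), c j * w j := by field_simp
      _ ≤ _ := h6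
  refine summable_of_sum_range_le (c := Real.exp 1 * ∑' j, c j)
    (fun k => Real.rpow_nonneg (Finset.prod_nonneg fun j _ => hc j) _) (fun N => ?_)
  calc _ ≤ ∑ k ∈ Finset.range N, Real.exp 1 *
        ((∑ j ∈ Finset.range (k+1), ((j:ℝ)+1) * c j) / (((k:ℝ)+1)*((k:ℝ)+2))) :=
        Finset.sum_le_sum fun k _ => key k
    _ = Real.exp 1 * ∑ k ∈ Finset.range N,
        ((∑ j ∈ Finset.range (k+1), ((j:ℝ)+1) * c j) / (((k:ℝ)+1)*((k:ℝ)+2))) := by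
        rw [Finset.mul_sum]
    _ ≤ Real.exp 1 * ∑ j ∈ Finset.range N, c j := by
        refine mul_le_mul_of_nonneg_left ?_ (Real.exp_pos 1).le
        rw [← carl_aux c N]
        have : 0 ≤ (∑ j ∈ Finset.range N, ((j:ℝ)+1) * c j) / ((N:ℝ)+1) :=
          div_nonneg (Finset.sum_nonneg fun j _ => mul_nonneg (by positivity) (hc j)) (by positivity)
        linarith
    _ ≤ _ := by
        gcongr
        exact hs.sum_le_tsum _ (fun j _ => hc j)

lemma inner_eq_zero_of_span {H : Type*} [NormedAddCommGroup H] [InnerProductSpace ℂ H]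
    (g : H) (s : Set H) (hs : ∀ x ∈ s, inner ℂ g x = 0) {w : H} (hw : w ∈ Submodule.span ℂ s) :
    inner ℂ g w = 0 := by
  induction hw using Submodule.span_induction with
  | mem x h => exact hs x h
  | zero => simp
  | add x y _ _ hx hy => rw [inner_add_right, hx, hy, add_zero]
  | smul a x _ hx => rw [inner_smul_right, hx, mul_zero]

lemma inner_eq_of_span {H : Type*} [NormedAddCommGroup H] [InnerProductSpace ℂ H]
    (g g' : H) (s : Set H) (hs : ∀ x ∈ s, inner ℂ g x = inner ℂ g' x) {w : H}
    (hw : w ∈ Submodule.span ℂ s) :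
    inner ℂ g w = inner ℂ g' w := by
  have := inner_eq_zero_of_span (g - g') s (fun x hx => by
    rw [inner_sub_left, hs x hx, sub_self]) hw
  rwa [inner_sub_left, sub_eq_zero] at this

open InnerProductSpace in
/-- Orthogonal-polynomial estimate behind Carleman's criterion. -/
lemma hankel_core {H : Type*} [NormedAddCommGroup H] [InnerProductSpace ℂ H]
    {D : Type*} [AddCommGroup D] [Module ℂ D] (ι : D →ₗ[ℂ] H) (X : Module.End ℂ D)
    (hsym : ∀ p q, inner ℂ (ι (X p)) (ι q) = inner ℂ (ι p) (ι (X q))) (v : D)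
    (hdiv : (∀ k : ℕ, ι ((X ^ k) v) ≠ 0) → ¬ Summable fun k : ℕ => ‖ι ((X ^ (k+1)) v)‖ ^ (-(1:ℝ) / ((k:ℝ)+1)))
    (c : ℂ) (hc : |c.im| = 1) (h : H)
    (hh : ∀ p, inner ℂ h (ι (X p)) = c * inner ℂ h (ι p)) : inner ℂ h (ι v) = 0 := by
  by_contra hv
  set e : ℕ → H := fun k => ι ((X ^ k) v) with he
  set g : ℕ → H := gramSchmidt ℂ e with hg
  have hg0 : g 0 = ι v := by
    have := gramSchmidt_bot (𝕜 := ℂ) e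
    simpa [hg, he] using this
  have hlift : ∀ k, ∃ γ : D, ι γ = g k ∧
      ι (X γ) - e (k+1) ∈ Submodule.span ℂ (e '' Set.Iic k) := by
    intro k
    have h1 : e k - g k ∈ Submodule.span ℂ (e '' Set.Iio k) := by
      rw [← span_gramSchmidt_Iio ℂ e k]
      have hdec : e k - g k = ∑ i ∈ Finset.Iio k,
          (inner ℂ (g i) (e k) / (‖g i‖ : ℂ) ^ 2) • g i := by
        rw [sub_eq_iff_eq_add']; exact gramSchmidt_def'' ℂ e k
      rw [hdec]
      refine Submodule.sum_mem _ fun i hi => Submodule.smul_mem _ _ (Submodule.subset_span ?_)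
      exact ⟨i, by simpa using hi, rfl⟩
    have h2 : e '' Set.Iio k = ι '' ((fun j => (X ^ j) v) '' Set.Iio k) := by
      rw [Set.image_image]
    rw [h2, Submodule.span_image] at h1
    obtain ⟨w, hw, hw'⟩ := h1
    refine ⟨(X ^ k) v - w, by rw [map_sub, hw']; simp [he], ?_⟩
    have h3 : ι (X ((X ^ k) v - w)) - e (k+1) = - ι (X w) := by
      simp only [map_sub, he, pow_succ']
      simp
    rw [h3]
    refine Submodule.neg_mem _ ?_
    clear hw' h3
    induction hw using Submodule.span_induction with
    | mem x hx =>
      obtain ⟨j, hj, rfl⟩ := hx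
      refine Submodule.subset_span ⟨j+1, ?_, ?_⟩
      · simp only [Set.mem_Iio, Set.mem_Iic] at *; omega
      · simp only [he, pow_succ']; simp
    | zero => simp
    | add x y _ _ hx hy => rw [map_add, map_add]; exact Submodule.add_mem _ hx hy
    | smul a x _ hx => rw [map_smul, map_smul]; exact Submodule.smul_mem _ _ hx
  choose γ hγ hγ' using hlift
  set u : ℕ → ℂ := fun k => inner ℂ h (g k) with hu
  have horth : ∀ i j, i ≠ j → inner ℂ (g i) (g j) = 0 := fun i j hij =>
    gramSchmidt_orthogonal ℂ e hij
  have hself : ∀ i, inner ℂ (g i) (g i) = ((‖g i‖:ℂ))^2 := fun i => by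
    rw [inner_self_eq_norm_sq_to_K]; rfl
  set a : ℕ → ℂ := fun j => (starRingEnd ℂ) (u j) / (‖g j‖:ℂ)^2 with ha
  set η : ℕ → D := fun k => ∑ j ∈ Finset.range (k+1), a j • γ j with hη
  have hιη : ∀ k, ι (η k) = ∑ j ∈ Finset.range (k+1), a j • g j := fun k => by
    simp [hη, hγ]
  have hu0 : ∀ k, g k = 0 → u k = 0 := fun k hk => by simp [hu, hk]
  have hproj : ∀ k i, i ≤ k → inner ℂ h (g i) = inner ℂ (ι (η k)) (g i) := by
    intro k i hik
    rw [hιη, sum_inner, Finset.sum_eq_single i]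
    · rw [inner_smul_left, hself]
      by_cases h0 : g i = 0
      · simp [h0]
      · have : (‖g i‖:ℂ) ≠ 0 := by simpa using h0
        simp only [ha, map_div₀, Complex.conj_conj, map_pow, Complex.conj_ofReal]
        rw [div_mul_cancel₀ _ (pow_ne_zero 2 this)]
    · intro j _ hj
      rw [inner_smul_left, horth j i hj, mul_zero]
    · intro hi
      exact absurd (Finset.mem_range.2 (by omega)) hi
  have hproj' : ∀ k w, w ∈ Submodule.span ℂ (e '' Set.Iic k) →
      inner ℂ h w = inner ℂ (ι (η k)) w := by
    intro k w hw
    rw [← span_gramSchmidt_Iic ℂ e k] at hw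
    refine inner_eq_of_span _ _ _ ?_ hw
    rintro _ ⟨i, hi, rfl⟩
    exact hproj k i hi
  set S : ℕ → ℝ := fun k => ∑ j ∈ Finset.range (k+1), ‖u j‖^2 / ‖g j‖^2 with hS
  have hhη : ∀ k, inner ℂ h (ι (η k)) = (S k : ℂ) := by
    intro k
    rw [hιη, inner_sum]
    simp only [hS]
    push_cast
    refine Finset.sum_congr rfl fun j _ => ?_
    rw [inner_smul_right]
    simp only [ha]
    have : (starRingEnd ℂ) (u j) * u j = (‖u j‖:ℂ)^2 := Complex.conj_mul' _
    rw [← this]; ring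
  have hspan_le : ∀ i k, i ≤ k → Submodule.span ℂ (e '' Set.Iic i) ≤
      Submodule.span ℂ (e '' Set.Iic k) := fun i k hik =>
    Submodule.span_mono (Set.image_mono (Set.Iic_subset_Iic.2 hik))
  have hemem : ∀ i k, i ≤ k → e i ∈ Submodule.span ℂ (e '' Set.Iic k) := fun i k hik =>
    Submodule.subset_span ⟨i, hik, rfl⟩
  have hXγ : ∀ k, ι (X (γ k)) ∈ Submodule.span ℂ (e '' Set.Iic (k+1)) := by
    intro k
    have := Submodule.add_mem _ (hspan_le k (k+1) (by omega) (hγ' k)) (hemem (k+1) (k+1) le_rfl)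
    simpa using this
  have hXη : ∀ k, ι (X (η k)) ∈ Submodule.span ℂ (e '' Set.Iic (k+1)) := by
    intro k
    simp only [hη, map_sum, map_smul]
    refine Submodule.sum_mem _ fun j hj => Submodule.smul_mem _ _ ?_
    exact hspan_le (j+1) (k+1) (by simp at hj; omega) (hXγ j)
  have hgperp : ∀ k w, w ∈ Submodule.span ℂ (e '' Set.Iic k) → inner ℂ (g (k+1)) w = 0 := by
    intro k w hw
    refine inner_eq_zero_of_span _ _ ?_ hw
    rintro _ ⟨i, hi, rfl⟩
    exact gramSchmidt_inv_triangular ℂ e (by simp at hi; omega)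
  have hge : ∀ k, inner ℂ (g k) (e k) = (‖g k‖:ℂ)^2 := by
    intro k
    conv_lhs => rw [gramSchmidt_def'' ℂ e k]
    rw [← hg, inner_add_right, inner_sum, Finset.sum_eq_zero, add_zero, hself]
    intro i hi
    rw [inner_smul_right, horth k i (by simp at hi; omega), mul_zero]
  have hgXγ : ∀ k, inner ℂ (g (k+1)) (ι (X (γ k))) = (‖g (k+1)‖:ℂ)^2 := by
    intro k
    have h1 := hgperp k _ (hγ' k)
    rw [inner_sub_right, sub_eq_zero] at h1
    rw [h1, hge]
  have hgXη : ∀ k, inner ℂ (g (k+1)) (ι (X (η k))) = a k * (‖g (k+1)‖:ℂ)^2 := by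
    intro k
    simp only [hη, map_sum, map_smul, inner_sum, inner_smul_right]
    rw [Finset.sum_range_succ, hgXγ, Finset.sum_eq_zero, zero_add]
    intro j hj
    rw [hgperp k _ (hspan_le (j+1) k (by simpa using hj) (hXγ j)), mul_zero]
  have hmain : ∀ k, c * (S k : ℂ) = inner ℂ (ι (η k)) (ι (X (η k)))
      + u (k+1) * (starRingEnd ℂ) (u k) / (‖g k‖:ℂ)^2 := by
    intro k
    rw [← hhη, ← hh, hproj' (k+1) _ (hXη k)]
    have : ι (η (k+1)) = ι (η k) + a (k+1) • g (k+1) := by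
      rw [hιη, hιη, Finset.sum_range_succ]
    rw [this, inner_add_left, inner_smul_left, hgXη]
    congr 1
    by_cases h0 : g (k+1) = 0
    · simp [h0, hu0 _ h0]
    · have h0' : (‖g (k+1)‖:ℂ) ≠ 0 := by simpa using h0
      simp only [ha, map_div₀, Complex.conj_conj, map_pow, Complex.conj_ofReal]
      field_simp
  have hreal : ∀ k, (inner ℂ (ι (η k)) (ι (X (η k)))).im = 0 := by
    intro k
    have h1 := hsym (η k) (η k)
    rw [← inner_conj_symm] at h1
    have h2 := congrArg Complex.im h1
    simp only [Complex.conj_im] at h2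
    linarith
  have hSnn : ∀ k, 0 ≤ S k := fun k => Finset.sum_nonneg fun j _ => by positivity
  have hSle : ∀ k, S k ≤ ‖u (k+1)‖ * ‖u k‖ / ‖g k‖^2 := by
    intro k
    have h1 := congrArg Complex.im (hmain k)
    rw [Complex.add_im, hreal, zero_add, Complex.im_mul_ofReal] at h1
    have h2 : S k = |c.im * S k| := by rw [abs_mul, hc, one_mul, abs_of_nonneg (hSnn k)]
    rw [h2, h1]
    refine (Complex.abs_im_le_norm _).trans ?_
    simp
  have hu0ne : u 0 ≠ 0 := by simpa [hu, hg0] using hv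
  have hg0ne : g 0 ≠ 0 := fun h0 => hu0ne (hu0 0 h0)
  set s0 : ℝ := ‖u 0‖^2 / ‖g 0‖^2 with hs0
  have hs0pos : 0 < s0 := by
    have := norm_pos_iff.2 hu0ne
    have := norm_pos_iff.2 hg0ne
    positivity
  have hs0S : ∀ k, s0 ≤ S k := fun k =>
    Finset.single_le_sum (f := fun j => ‖u j‖^2 / ‖g j‖^2) (fun j _ => by positivity)
      (Finset.mem_range.2 (Nat.succ_pos k))
  have hgne : ∀ k, g k ≠ 0 := by
    intro k h0
    have := (hs0S k).trans (hSle k)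
    simp [h0] at this
    linarith
  have hgpos : ∀ k, 0 < ‖g k‖ := fun k => norm_pos_iff.2 (hgne k)
  have hSbd : ∀ k, S k ≤ ‖h‖^2 := by
    intro k
    have hmem : ι (η k) ∈ Submodule.span ℂ (e '' Set.Iic k) := by
      rw [← span_gramSchmidt_Iic ℂ e k, hιη]
      exact Submodule.sum_mem _ fun j hj => Submodule.smul_mem _ _
        (Submodule.subset_span ⟨j, by simp at hj ⊢; omega, rfl⟩)
    have h1 := hproj' k _ hmem
    rw [hhη, inner_self_eq_norm_sq_to_K] at h1
    have h2 : S k = ‖ι (η k)‖^2 := by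
      apply Complex.ofReal_injective
      rw [h1]; push_cast; rfl
    have h3 : S k ≤ ‖h‖ * ‖ι (η k)‖ := by
      have := norm_inner_le_norm (𝕜 := ℂ) h (ι (η k))
      rw [hhη, Complex.norm_real, Real.norm_eq_abs, abs_of_nonneg (hSnn k)] at this
      exact this
    nlinarith [norm_nonneg h, norm_nonneg (ι (η k)), sq_nonneg (‖h‖ - ‖ι (η k)‖)]
  set δ : ℕ → ℝ := fun k => ‖u k‖^2 / ‖g k‖^2 with hδ
  have hδs : Summable δ := by
    refine summable_of_sum_range_le (c := ‖h‖^2) (fun k => by positivity) (fun N => ?_)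
    refine le_trans ?_ (hSbd N)
    exact Finset.sum_le_sum_of_subset_of_nonneg (Finset.range_mono (Nat.le_succ N))
      (fun j _ _ => by positivity)
  set cc : ℕ → ℝ := fun k => ‖g k‖ / ‖g (k+1)‖ with hcc
  have hccs : Summable cc := by
    have h1 : Summable fun k => (1/s0) * ((δ k + δ (k+1)) / 2) :=
      ((hδs.add ((summable_nat_add_iff 1).2 hδs)).div_const 2).mul_left _
    refine Summable.of_nonneg_of_le (fun k => by positivity) (fun k => ?_) h1
    have h2 := (hs0S k).trans (hSle k)
    have p1 := hgpos k
    have p2 := hgpos (k+1)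
    have h3 : s0 * cc k ≤ (δ k + δ (k+1)) / 2 := by
      calc s0 * cc k ≤ (‖u (k+1)‖ * ‖u k‖ / ‖g k‖^2) * cc k := by gcongr
        _ = (‖u k‖ / ‖g k‖) * (‖u (k+1)‖ / ‖g (k+1)‖) := by simp only [hcc]; field_simp
        _ ≤ ((‖u k‖ / ‖g k‖)^2 + (‖u (k+1)‖ / ‖g (k+1)‖)^2) / 2 := by
          nlinarith [sq_nonneg ((‖u k‖ / ‖g k‖) - (‖u (k+1)‖ / ‖g (k+1)‖))]
        _ = _ := by simp only [hδ, div_pow]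
    rw [one_div, ← div_eq_inv_mul, le_div_iff₀ hs0pos, mul_comm]
    exact h3
  have hprod : ∀ k, ∏ j ∈ Finset.range k, cc j = ‖g 0‖ / ‖g k‖ := by
    intro k
    induction k with
    | zero => simp [(hgpos 0).ne']
    | succ k ih =>
      rw [Finset.prod_range_succ, ih]
      have := hgpos k
      simp only [hcc]; field_simp
  have hgle : ∀ k, ‖g k‖ ≤ ‖e k‖ := by
    intro k
    have h1 := norm_inner_le_norm (𝕜 := ℂ) (g k) (e k)
    rw [hge, norm_pow, Complex.norm_real, norm_norm] at h1
    have := hgpos k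
    nlinarith
  refine hdiv (fun k => norm_pos_iff.1 ((hgpos k).trans_le (hgle k))) ?_
  have hfin := carleman_summable cc (fun k => by positivity) hccs
  refine Summable.of_nonneg_of_le (fun k => by positivity) (fun k => ?_)
    (hfin.mul_left (max 1 (1/‖g 0‖)))
  have hek : 0 < ‖e (k+1)‖ := (hgpos _).trans_le (hgle _)
  have hk1 : (0:ℝ) < (k:ℝ)+1 := by positivity
  have hg0p := hgpos 0
  rw [hprod]
  have h1 : ‖e (k+1)‖ ^ (-(1:ℝ)/((k:ℝ)+1)) = (1/‖e (k+1)‖) ^ ((1:ℝ)/((k:ℝ)+1)) := by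
    rw [neg_div, Real.rpow_neg hek.le, one_div ‖e (k+1)‖, Real.inv_rpow hek.le]
  have h2 : (1:ℝ)/‖e (k+1)‖ ≤ (1/‖g 0‖) * (‖g 0‖ / ‖g (k+1)‖) := by
    have : (1/‖g 0‖) * (‖g 0‖ / ‖g (k+1)‖) = 1 / ‖g (k+1)‖ := by field_simp
    rw [this]
    exact one_div_le_one_div_of_le (hgpos _) (hgle _)
  have h3 : (1/‖g 0‖) ^ ((1:ℝ)/((k:ℝ)+1)) ≤ max 1 (1/‖g 0‖) := by
    rcases le_total (1/‖g 0‖) 1 with hl | hl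
    · exact (Real.rpow_le_one (by positivity) hl (by positivity)).trans (le_max_left _ _)
    · refine le_trans ?_ (le_max_right _ _)
      refine Real.rpow_le_self_of_one_le hl ?_
      rw [div_le_one hk1]; linarith [Nat.cast_nonneg (α := ℝ) k]
  change ‖e (k+1)‖ ^ (-(1:ℝ)/((k:ℝ)+1)) ≤ _
  rw [h1]
  calc _ ≤ ((1/‖g 0‖) * (‖g 0‖ / ‖g (k+1)‖)) ^ ((1:ℝ)/((k:ℝ)+1)) := by gcongr
    _ = (1/‖g 0‖) ^ ((1:ℝ)/((k:ℝ)+1)) * (‖g 0‖ / ‖g (k+1)‖) ^ ((1:ℝ)/((k:ℝ)+1)) :=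
      Real.mul_rpow (by positivity) (by positivity)
    _ ≤ _ := by gcongr

lemma hankel_dense {H : Type*} [NormedAddCommGroup H] [InnerProductSpace ℂ H] [CompleteSpace H]
    {D : Type*} [AddCommGroup D] [Module ℂ D] (ι : D →ₗ[ℂ] H) (X : Module.End ℂ D)
    (hsym : ∀ p q, inner ℂ (ι (X p)) (ι q) = inner ℂ (ι p) (ι (X q))) (v : D)
    (hdiv : (∀ k : ℕ, ι ((X ^ k) v) ≠ 0) → ¬ Summable fun k : ℕ => ‖ι ((X ^ (k+1)) v)‖ ^ (-(1:ℝ) / ((k:ℝ)+1)))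
    (c : ℂ) (hc : |c.im| = 1) (ε : ℝ) (hε : 0 < ε) :
    ∃ q : D, ‖ι v - ι (X q - c • q)‖ < ε := by
  set W : Submodule ℂ H := LinearMap.range (ι ∘ₗ (X - c • LinearMap.id)) with hW
  have h1 : ι v ∈ Wᗮᗮ := by
    rw [Submodule.mem_orthogonal]
    intro h hh
    refine hankel_core ι X hsym v hdiv c hc h fun p => ?_
    rw [Submodule.mem_orthogonal'] at hh
    have := hh (ι (X p - c • p)) ⟨p, by simp⟩
    rw [map_sub, map_smul, inner_sub_right, inner_smul_right, sub_eq_zero] at this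
    exact this
  rw [Submodule.orthogonal_orthogonal_eq_closure] at h1
  obtain ⟨w, ⟨q, rfl⟩, hw⟩ := Metric.mem_closure_iff.1 h1 ε hε
  exact ⟨q, by simpa [dist_eq_norm] using hw⟩

lemma scale_summable (a t : ℕ → ℝ) (ha : ∀ k, 0 < a k) (ht : ∀ k, 1 ≤ t k) (K : ℝ) (hK : 0 < K)
    (hs : Summable fun k => a k ^ (-(1:ℝ) / t k)) :
    Summable fun k => (K * a k) ^ (-(1:ℝ) / t k) := by
  refine Summable.of_nonneg_of_le (fun k => by have := ha k; positivity) (fun k => ?_)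
    (hs.mul_left (max 1 K⁻¹))
  have hak := ha k
  rw [Real.mul_rpow hK.le hak.le]
  gcongr
  have htk : 0 < t k := by linarith [ht k]
  rw [neg_div, Real.rpow_neg hK.le, ← Real.inv_rpow hK.le]
  have h1 : 1 / t k ≤ 1 := by rw [div_le_one htk]; exact ht k
  rcases le_total K⁻¹ 1 with hl | hl
  · exact (Real.rpow_le_one (by positivity) hl (by positivity)).trans (le_max_left _ _)
  · exact (Real.rpow_le_self_of_one_le hl h1).trans (le_max_right _ _)

lemma growth_pos (m : ℕ → ℝ) (hm0 : ∀ k, 0 ≤ m k)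
    (hlc : ∀ k, m (k+1)^2 ≤ m k * m (k+2))
    (hdiv : ¬ Summable fun k : ℕ => m (k+1) ^ (-(1:ℝ) / (2 * ((k:ℝ)+1)))) (k : ℕ) : 0 < m k := by
  refine lt_of_le_of_ne (hm0 k) fun h0 => hdiv ?_
  have h1 : ∀ j, m (k+j) = 0 := by
    intro j
    induction j with
    | zero => exact h0.symm
    | succ j ih =>
      have := hlc (k+j)
      rw [ih, zero_mul] at this
      exact pow_eq_zero_iff (two_ne_zero) |>.1 (le_antisymm this (sq_nonneg _))
  refine summable_of_ne_finset_zero (s := Finset.range k) fun j hj => ?_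
  obtain ⟨i, hi⟩ : ∃ i, j + 1 = k + i := ⟨j + 1 - k, by simp at hj; omega⟩
  rw [hi, h1 i, Real.zero_rpow]
  have : (0:ℝ) < 2 * ((j:ℝ)+1) := by positivity
  exact (div_neg_of_neg_of_pos (by norm_num) this).ne

lemma growth_mono (s : ℕ → ℝ) (hs : ∀ k, 0 < s k) (hs0 : s 0 = 1)
    (hlc : ∀ k, s (k+1)^2 ≤ s k * s (k+2)) (k : ℕ) : s k ^ (k+1) ≤ s (k+1) ^ k := by
  induction k with
  | zero => simp [hs0]
  | succ k ih =>
    have h1 : (s (k+1)^2)^(k+1) ≤ (s k * s (k+2))^(k+1) :=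
      pow_le_pow_left₀ (sq_nonneg _) (hlc k) _
    rw [mul_pow] at h1
    have p1 := hs (k+1)
    have p2 := hs (k+2)
    have h2 : (s (k+1)^2)^(k+1) ≤ s (k+1)^k * s (k+2)^(k+1) :=
      h1.trans (by gcongr)
    have h3 : (s (k+1)^2)^(k+1) = s (k+1)^k * s (k+1)^(k+1+1) := by
      rw [← pow_mul, ← pow_add]; congr 1; omega
    rw [h3] at h2
    exact le_of_mul_le_mul_left h2 (by positivity)

lemma growth (m : ℕ → ℝ) (hm0 : ∀ k, 0 ≤ m k)
    (hlc : ∀ k, m (k+1)^2 ≤ m k * m (k+2))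
    (hdiv : ¬ Summable fun k : ℕ => m (k+1) ^ (-(1:ℝ) / (2 * ((k:ℝ)+1))))
    (E : ℕ → ℝ) (hE : ∀ k, 0 < E k) (C : ℝ) (hEm : ∀ k, E k ^ 4 ≤ C * m (2*k)) :
    ¬ Summable fun k : ℕ => E (k+1) ^ (-(1:ℝ) / ((k:ℝ)+1)) := by
  intro hsum
  apply hdiv
  have hm := growth_pos m hm0 hlc hdiv
  have hC : 0 < C := by
    have h1 := hEm 0
    have h2 : 0 < E 0 ^ 4 := pow_pos (hE 0) 4
    have h3 := hm (2*0)
    by_contra hC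
    nlinarith
  -- step 1
  have s1 : Summable fun k : ℕ => (C * m (2*(k+1))) ^ (-(1:ℝ) / (4 * ((k:ℝ)+1))) := by
    refine Summable.of_nonneg_of_le (fun k => by have := hm (2*(k+1)); positivity)
      (fun k => ?_) hsum
    have hk : (0:ℝ) < (k:ℝ)+1 := by positivity
    have h1 : E (k+1) ^ (-(1:ℝ) / ((k:ℝ)+1)) = (E (k+1) ^ 4) ^ (-(1:ℝ) / (4 * ((k:ℝ)+1))) := by
      rw [← Real.rpow_natCast, ← Real.rpow_mul (hE _).le]
      congr 1
      push_cast
      field_simp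
    rw [h1]
    refine Real.rpow_le_rpow_of_nonpos (pow_pos (hE _) 4) (hEm (k+1)) ?_
    exact (div_neg_of_neg_of_pos (by norm_num) (by positivity)).le
  set s : ℕ → ℝ := fun k => m k / m 0 with hs
  have hspos : ∀ k, 0 < s k := fun k => div_pos (hm k) (hm 0)
  have hs0 : s 0 = 1 := div_self (hm 0).ne'
  have hslc : ∀ k, s (k+1)^2 ≤ s k * s (k+2) := by
    intro k
    have := hm 0
    simp only [hs]
    rw [div_pow, div_mul_div_comm, ← sq]
    gcongr
    exact hlc k
  have s2 : Summable fun k : ℕ => s (2*(k+1)) ^ (-(1:ℝ) / (4 * ((k:ℝ)+1))) := by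
    have := scale_summable (fun k => C * m (2*(k+1))) (fun k => 4 * ((k:ℝ)+1))
      (fun k => mul_pos hC (hm _)) (fun k => by linarith [Nat.cast_nonneg (α := ℝ) k])
      (C⁻¹ * (m 0)⁻¹) (mul_pos (inv_pos.2 hC) (inv_pos.2 (hm 0))) s1
    refine this.congr fun k => ?_
    congr 1
    simp only [hs]
    field_simp
  set b : ℕ → ℝ := fun k => s k ^ (-(1:ℝ) / (2 * (k:ℝ))) with hb
  have hbanti : ∀ k, 1 ≤ k → b (k+1) ≤ b k := by
    intro k hk
    have hk' : (0:ℝ) < k := by exact_mod_cast hk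
    have h1 := growth_mono s hspos hs0 hslc k
    have h2 := Real.rpow_le_rpow_of_nonpos (pow_pos (hspos k) _) h1
      (z := -(1:ℝ)/(2*(k:ℝ)*((k:ℝ)+1))) (div_neg_of_neg_of_pos (by norm_num) (by positivity)).le
    rw [← Real.rpow_natCast, ← Real.rpow_natCast, ← Real.rpow_mul (hspos _).le,
      ← Real.rpow_mul (hspos _).le] at h2
    simp only [hb]
    convert h2 using 2
    · push_cast; field_simp
    · push_cast; field_simp
  have hbnn : ∀ k, 0 ≤ b k := fun k => by have := hspos k; positivity
  have e1 : Summable fun k : ℕ => b (2*(k+1)) := by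
    refine s2.congr fun k => ?_
    simp only [hb]
    congr 2
    push_cast; ring
  have e2 : Summable fun k : ℕ => b (2*(k+1)+1) :=
    Summable.of_nonneg_of_le (fun k => hbnn _) (fun k => hbanti _ (by omega)) e1
  have e1' : Summable fun k : ℕ => b (2*k) := (summable_nat_add_iff (f := fun k => b (2*k)) 1).1 e1
  have e2' : Summable fun k : ℕ => b (2*k+1) :=
    (summable_nat_add_iff (f := fun k => b (2*k+1)) 1).1 e2
  have e3 : Summable b := (e1'.hasSum.even_add_odd e2'.hasSum).summable
  have e4 : Summable fun k : ℕ => s (k+1) ^ (-(1:ℝ) / (2 * ((k:ℝ)+1))) := by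
    refine ((summable_nat_add_iff 1).2 e3).congr fun k => ?_
    simp only [hb]; push_cast; rfl
  have := scale_summable (fun k => s (k+1)) (fun k => 2 * ((k:ℝ)+1))
      (fun k => hspos _) (fun k => by linarith [Nat.cast_nonneg (α := ℝ) k])
      (m 0) (hm 0) e4
  refine this.congr fun k => ?_
  congr 1
  simp only [hs]
  have := (hm 0).ne'
  field_simp

/-- Abstract completion of a semi-inner product. -/
lemma exists_hilbert {D : Type} [AddCommGroup D] [Module ℂ D] (B : D → D → ℂ)
    (h1 : ∀ x y, (starRingEnd ℂ) (B y x) = B x y) (h2 : ∀ x, 0 ≤ (B x x).re)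
    (h3 : ∀ x y z, B (x + y) z = B x z + B y z)
    (h4 : ∀ x y (r : ℂ), B (r • x) y = (starRingEnd ℂ) r * B x y) :
    ∃ (H : Type) (_ : NormedAddCommGroup H) (_ : InnerProductSpace ℂ H) (_ : CompleteSpace H)
      (ι : D →ₗ[ℂ] H), DenseRange ι ∧ ∀ p q, inner ℂ (ι p) (ι q) = B p q := by
  let core : PreInnerProductSpace.Core ℂ D :=
    { inner := B
      conj_inner_symm := h1
      re_inner_nonneg := h2
      add_left := h3
      smul_left := h4 }
  letI : SeminormedAddCommGroup D := @InnerProductSpace.Core.toSeminormedAddCommGroup ℂ D _ _ _ core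
  letI : InnerProductSpace ℂ D := InnerProductSpace.ofCore core
  refine ⟨UniformSpace.Completion D, inferInstance, inferInstance, inferInstance,
    (UniformSpace.Completion.toComplₗᵢ (𝕜 := ℂ) (E := D)).toLinearMap, ?_, ?_⟩
  · exact UniformSpace.Completion.denseRange_coe
  · intro p q
    exact UniformSpace.Completion.inner_coe p q

/-- real Riesz functional as a linear map -/
def Lr {n : ℕ} (y : (Fin n → ℕ) → ℝ) : MvPolynomial (Fin n) ℝ →ₗ[ℝ] ℝ :=
  (basisMonomials (Fin n) ℝ).constr ℝ (fun m => y (fun i => m i))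

/-- complex Riesz functional -/
def Lc {n : ℕ} (y : (Fin n → ℕ) → ℝ) : MvPolynomial (Fin n) ℂ →ₗ[ℂ] ℂ :=
  (basisMonomials (Fin n) ℂ).constr ℂ (fun m => ((y (fun i => m i) : ℝ) : ℂ))

/-- coefficientwise conjugation -/
def cj {n : ℕ} : MvPolynomial (Fin n) ℂ →+* MvPolynomial (Fin n) ℂ := MvPolynomial.map (starRingEnd ℂ)

/-- real polynomials as complex polynomials -/
def rm {n : ℕ} : MvPolynomial (Fin n) ℝ →+* MvPolynomial (Fin n) ℂ := MvPolynomial.map Complex.ofRealHom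

section
variable {n : ℕ} (y : (Fin n → ℕ) → ℝ)

lemma Lr_monomial (m : Fin n →₀ ℕ) (a : ℝ) : Lr y (monomial m a) = a * y (fun i => m i) := by
  have h : (monomial m a : MvPolynomial (Fin n) ℝ) = a • (basisMonomials (Fin n) ℝ) m := by
    simp [smul_monomial]
  rw [h, map_smul, Lr, Module.Basis.constr_basis, smul_eq_mul]

lemma Lc_monomial (m : Fin n →₀ ℕ) (a : ℂ) : Lc y (monomial m a) = a * (y (fun i => m i) : ℝ) := by
  have h : (monomial m a : MvPolynomial (Fin n) ℂ) = a • (basisMonomials (Fin n) ℂ) m := by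
    simp [smul_monomial]
  rw [h, map_smul, Lc, Module.Basis.constr_basis, smul_eq_mul]

lemma riesz_eq (p : MvPolynomial (Fin n) ℝ) : riesz y p = Lr y p := by
  conv_rhs => rw [← support_sum_monomial_coeff p]
  rw [map_sum, riesz]
  exact Finset.sum_congr rfl fun m _ => (Lr_monomial y m _).symm

lemma cj_cj (p : MvPolynomial (Fin n) ℂ) : cj (cj p) = p := by
  induction p using MvPolynomial.induction_on' with
  | monomial m a => simp [cj]
  | add p q hp hq => simp [hp, hq]

lemma cj_rm (p : MvPolynomial (Fin n) ℝ) : cj (rm p) = rm p := by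
  induction p using MvPolynomial.induction_on' with
  | monomial m a => simp [cj, rm]
  | add p q hp hq => simp [hp, hq]

lemma Lc_cj (p : MvPolynomial (Fin n) ℂ) : Lc y (cj p) = (starRingEnd ℂ) (Lc y p) := by
  induction p using MvPolynomial.induction_on' with
  | monomial m a => simp [cj, Lc_monomial]
  | add p q hp hq => simp [hp, hq]

lemma Lc_rm (p : MvPolynomial (Fin n) ℝ) : Lc y (rm p) = (Lr y p : ℝ) := by
  induction p using MvPolynomial.induction_on' with
  | monomial m a => simp [rm, Lc_monomial, Lr_monomial]
  | add p q hp hq => simp [hp, hq]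

lemma exists_re_im (p : MvPolynomial (Fin n) ℂ) :
    ∃ a b : MvPolynomial (Fin n) ℝ, p = rm a + C Complex.I * rm b := by
  induction p using MvPolynomial.induction_on' with
  | monomial m a =>
    refine ⟨monomial m a.re, monomial m a.im, ?_⟩
    simp only [rm, map_monomial, C_mul_monomial, ← map_add]
    congr 1
    simp [mul_comm Complex.I, Complex.re_add_im]
  | add p q hp hq =>
    obtain ⟨a, b, rfl⟩ := hp
    obtain ⟨a', b', rfl⟩ := hq
    exact ⟨a + a', b + b', by simp; ring⟩

lemma form_pos (hpos : ∀ a, 0 ≤ Lr y (a^2)) (p : MvPolynomial (Fin n) ℂ) :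
    0 ≤ (Lc y (cj p * p)).re := by
  obtain ⟨a, b, rfl⟩ := exists_re_im p
  have hI : (C Complex.I : MvPolynomial (Fin n) ℂ) * C Complex.I = -1 := by
    rw [← C_mul, Complex.I_mul_I]; simp
  have hcI : cj (C Complex.I : MvPolynomial (Fin n) ℂ) = - C Complex.I := by
    simp [cj]
  have : cj (rm a + C Complex.I * rm b) * (rm a + C Complex.I * rm b) = rm (a^2 + b^2) := by
    rw [map_add, map_mul, cj_rm, cj_rm, hcI, map_add, map_pow, map_pow]
    linear_combination (- rm b ^ 2) * hI
  rw [this, Lc_rm, Complex.ofReal_re, map_add]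
  exact add_nonneg (hpos a) (hpos b)

lemma exists_gns (hpos : ∀ a, 0 ≤ Lr y (a^2)) :
    ∃ (H : Type) (_ : NormedAddCommGroup H) (_ : InnerProductSpace ℂ H) (_ : CompleteSpace H)
      (ι : MvPolynomial (Fin n) ℂ →ₗ[ℂ] H), DenseRange ι ∧
        ∀ p q, inner ℂ (ι p) (ι q) = Lc y (cj p * q) := by
  refine exists_hilbert (fun p q => Lc y (cj p * q)) ?_ (form_pos y hpos) ?_ ?_
  · intro p q
    rw [← Lc_cj, map_mul, cj_cj, mul_comm]
  · intro p q r
    simp [add_mul]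
  · intro p q r
    have : cj (r • p) = (starRingEnd ℂ) r • cj p := by
      simp [cj, smul_eq_C_mul]
    rw [this, smul_mul_assoc, map_smul, smul_eq_mul]

/-- density property: `(x_j - c) ℂ[x]` is dense -/
def Dens : Prop := ∀ (j : Fin n) (c : ℂ), |c.im| = 1 → ∀ (p : MvPolynomial (Fin n) ℂ) (ε : ℝ), 0 < ε →
  ∃ q, (Lc y (cj (p - (X j - C c) * (q * p)) * (p - (X j - C c) * (q * p)))).re < ε

set_option maxHeartbeats 1000000 in
lemma dens_of_carleman (hpos : ∀ a, 0 ≤ Lr y (a^2))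
    (hcar : ∀ i : Fin n, Tendsto (fun N : ℕ => ∑ k ∈ Finset.Icc 1 N,
          (riesz y ((X i : MvPolynomial (Fin n) ℝ) ^ (2 * k))) ^ (-(1 : ℝ) / (2 * (k : ℝ))))
        atTop atTop) : Dens y := by
  intro j c hc p ε hε
  obtain ⟨H, _, _, _, ι, -, hι⟩ := exists_gns y hpos
  have hns : ∀ p, ‖ι p‖^2 = (Lc y (cj p * p)).re := by
    intro p
    have := inner_self_eq_norm_sq (𝕜 := ℂ) (ι p)
    rw [← this, hι]; rfl
  set m : ℕ → ℝ := fun k => Lr y (X j ^ (2*k)) with hm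
  have hcjX : ∀ k : ℕ, cj (X j ^ k : MvPolynomial (Fin n) ℂ) = X j ^ k := by intro k; simp [cj]
  have hrmX : ∀ k : ℕ, rm (X j ^ k : MvPolynomial (Fin n) ℝ) = X j ^ k := by intro k; simp [rm]
  have hmn : ∀ k, ‖ι (X j ^ k)‖^2 = m k := by
    intro k
    rw [hns, hcjX, ← pow_add, ← hrmX, Lc_rm, Complex.ofReal_re, ← two_mul]
  have hm0 : ∀ k, 0 ≤ m k := fun k => by rw [← hmn]; positivity
  have hlc : ∀ k, m (k+1)^2 ≤ m k * m (k+2) := by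
    intro k
    have h1 := norm_inner_le_norm (𝕜 := ℂ) (ι (X j ^ k)) (ι (X j ^ (k+2)))
    rw [hι, hcjX, ← pow_add, ← hrmX, Lc_rm, Complex.norm_real,
      show k + (k+2) = 2*(k+1) by ring] at h1
    rw [← hmn k, ← hmn (k+2), ← mul_pow]
    change |m (k+1)| ≤ _ at h1
    rw [abs_of_nonneg (hm0 _)] at h1
    exact pow_le_pow_left₀ (hm0 _) h1 2
  have hdiv : ¬ Summable fun k : ℕ => m (k+1) ^ (-(1:ℝ) / (2 * ((k:ℝ)+1))) := by
    rw [not_summable_iff_tendsto_nat_atTop_of_nonneg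
      (fun k => Real.rpow_nonneg (hm0 _) _)]
    refine (hcar j).congr fun N => ?_
    rw [← Finset.sum_image (s := Finset.range N) (g := fun k => k + 1)
      (f := fun k : ℕ => (m k) ^ (-(1 : ℝ) / (2 * (k : ℝ)))) (by intro a _ b _ h; simpa using h)
      |>.trans (Finset.sum_congr rfl fun k _ => by push_cast; rfl)]
    refine Finset.sum_congr ?_ fun k _ => by rw [riesz_eq]
    ext k; simp only [Finset.mem_Icc, Finset.mem_image, Finset.mem_range]
    exact ⟨fun h => ⟨k - 1, by omega, by omega⟩, by rintro ⟨a, h, rfl⟩; omega⟩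
  obtain ⟨q, hq⟩ := hankel_dense (ι ∘ₗ LinearMap.mulRight ℂ p) (LinearMap.mulLeft ℂ (X j)) (fun a b => by
      simp only [LinearMap.comp_apply, LinearMap.mulRight_apply]
      rw [hι, hι]
      simp only [LinearMap.mulLeft_apply, map_mul]
      have := hcjX 1
      rw [pow_one] at this
      rw [this]; congr 1; ring) 1 (fun hne => by
      have e1 : ∀ k : ℕ, (ι ∘ₗ LinearMap.mulRight ℂ p) (((LinearMap.mulLeft ℂ (X j))^k) 1) =
          ι (X j ^ k * p) := by
        intro k; rw [LinearMap.pow_mulLeft, LinearMap.mulLeft_apply]; simp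
      simp only [e1] at hne ⊢
      refine growth m hm0 hlc hdiv (fun k => ‖ι (X j ^ k * p)‖)
        (fun k => norm_pos_iff.2 (hne k)) (‖ι (cj p * p)‖^2) (fun k => ?_)
      have h1 : ‖ι (X j ^ k * p)‖^2 = ‖inner ℂ (ι (cj p * p)) (ι (X j ^ (2*k)))‖ := by
        have h3 : inner ℂ (ι (cj p * p)) (ι (X j ^ (2*k))) = inner ℂ (ι (X j ^ k * p)) (ι (X j ^ k * p)) := by
          rw [hι, hι, map_mul cj, map_mul cj, cj_cj, hcjX]; congr 1; ring
        rw [h3, inner_self_eq_norm_sq_to_K, norm_pow]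
        simp
      have h2 := norm_inner_le_norm (𝕜 := ℂ) (ι (cj p * p)) (ι (X j ^ (2*k)))
      rw [← h1] at h2
      calc ‖ι (X j ^ k * p)‖^4 = (‖ι (X j ^ k * p)‖^2)^2 := by ring
        _ ≤ (‖ι (cj p * p)‖ * ‖ι (X j ^ (2*k))‖)^2 := by gcongr
        _ = _ := by rw [mul_pow, hmn]) c hc (Real.sqrt ε) (Real.sqrt_pos.2 hε)
  refine ⟨q, ?_⟩
  rw [← hns, map_sub]
  have : (ι ∘ₗ LinearMap.mulRight ℂ p) (LinearMap.mulLeft ℂ (X j) q - c • q) =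
      ι ((X j - C c) * (q * p)) := by
    rw [smul_eq_C_mul, LinearMap.comp_apply, LinearMap.mulRight_apply, LinearMap.mulLeft_apply,
      ← sub_mul, mul_assoc]
  rw [this] at hq
  simp only [LinearMap.comp_apply, LinearMap.mulRight_apply, one_mul] at hq
  calc _ < (Real.sqrt ε)^2 := by gcongr
    _ = ε := Real.sq_sqrt hε.le
end

/-- complex evaluation -/
def evc {n : ℕ} (p : MvPolynomial (Fin n) ℂ) (x : EuclideanSpace ℝ (Fin n)) : ℂ :=
  eval (fun i => ((x i : ℝ) : ℂ)) p

section
variable {n : ℕ}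

lemma evc_cj (p : MvPolynomial (Fin n) ℂ) (x : EuclideanSpace ℝ (Fin n)) :
    evc (cj p) x = (starRingEnd ℂ) (evc p x) := by
  induction p using MvPolynomial.induction_on with
  | C a => simp [cj, evc]
  | add p q hp hq => simp only [evc, map_add] at *; rw [hp, hq]
  | mul_X p i hp => simp only [evc, map_mul] at *; rw [hp]; simp [cj]

lemma evc_cont (p : MvPolynomial (Fin n) ℂ) : Continuous (evc p) := by
  unfold evc
  induction p using MvPolynomial.induction_on with
  | C a => simp only [eval_C]; exact continuous_const
  | add p q hp hq => simp only [map_add]; exact hp.add hq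
  | mul_X p i hp =>
    simp only [map_mul, eval_X]
    exact hp.mul (Complex.continuous_ofReal.comp (by fun_prop))

lemma evc_monomial (m : Fin n →₀ ℕ) (a : ℂ) (x : EuclideanSpace ℝ (Fin n)) :
    evc (monomial m a) x = a * ((monom (fun i => m i) x : ℝ) : ℂ) := by
  simp only [evc, eval_monomial, monom]
  rw [Finsupp.prod_fintype _ _ (by simp)]
  push_cast
  rfl

lemma rep_int {y : (Fin n → ℕ) → ℝ} {μ : Measure (EuclideanSpace ℝ (Fin n))}
    (h : Represents μ y) (p : MvPolynomial (Fin n) ℂ) :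
    Integrable (evc p) μ ∧ ∫ x, evc p x ∂μ = Lc y p := by
  induction p using MvPolynomial.induction_on' with
  | monomial m a =>
    have h1 := h (fun i => m i)
    have h2 : (evc (monomial m a) : EuclideanSpace ℝ (Fin n) → ℂ) =
      fun x => a * ((monom (fun i => m i) x : ℝ) : ℂ) := by
      funext x; exact evc_monomial m a x
    rw [h2]
    refine ⟨(h1.1.ofReal).const_mul a, ?_⟩
    rw [integral_const_mul, integral_complex_ofReal, h1.2, Lc_monomial]
  | add p q hp hq =>
    have h2 : (evc (p + q) : EuclideanSpace ℝ (Fin n) → ℂ) = fun x => evc p x + evc q x := by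
      funext x; simp [evc]
    rw [h2]
    refine ⟨hp.1.add hq.1, ?_⟩
    rw [integral_add hp.1 hq.1, hp.2, hq.2, map_add]

lemma rep_univ {y : (Fin n → ℕ) → ℝ} {μ : Measure (EuclideanSpace ℝ (Fin n))}
    (h : Represents μ y) : μ Set.univ = ENNReal.ofReal (y 0) ∧ IsFiniteMeasure μ := by
  have h1 := h 0
  have h2 : (monom 0 : EuclideanSpace ℝ (Fin n) → ℝ) = fun _ => 1 := by
    funext x; simp [monom]
  rw [h2] at h1
  have h3 : IsFiniteMeasure μ := by
    have := h1.1
    rw [integrable_const_iff] at this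
    rcases this with h | h
    · norm_num at h
    · exact h
  refine ⟨?_, h3⟩
  rw [← h1.2]
  simp

lemma rep_norm {y : (Fin n → ℕ) → ℝ} {μ : Measure (EuclideanSpace ℝ (Fin n))}
    (h : Represents μ y) (p : MvPolynomial (Fin n) ℂ) :
    eLpNorm (evc p) 2 μ ^ 2 = ENNReal.ofReal (Lc y (cj p * p)).re := by
  have h1 := rep_int h (cj p * p)
  have h2 : (evc (cj p * p) : EuclideanSpace ℝ (Fin n) → ℂ) = fun x => ((‖evc p x‖^2 : ℝ) : ℂ) := by
    funext x
    have : evc (cj p * p) x = evc (cj p) x * evc p x := by simp [evc]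
    rw [this, evc_cj, mul_comm, Complex.mul_conj, Complex.normSq_eq_norm_sq]
  rw [h2] at h1
  have h3 : Integrable (fun x => ‖evc p x‖^2) μ := by
    exact h1.1.re
  have h4 : ∫ x, ((‖evc p x‖^2 : ℝ) : ℂ) ∂μ = Lc y (cj p * p) := h1.2
  rw [← h4, integral_complex_ofReal]
  simp only [Complex.ofReal_re]
  rw [ofReal_integral_eq_lintegral_ofReal h3 (ae_of_all _ fun x => by positivity)]
  rw [eLpNorm_eq_lintegral_rpow_enorm_toReal (by norm_num) (by norm_num)]
  rw [← ENNReal.rpow_natCast, ← ENNReal.rpow_mul]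
  simp

/-- approximability of multiplication by `f` -/
def Gp (y : (Fin n → ℕ) → ℝ) (f : BoundedContinuousFunction (EuclideanSpace ℝ (Fin n)) ℂ) : Prop :=
  ∀ p : MvPolynomial (Fin n) ℂ, ∀ ε : ℝ, 0 < ε → ∃ q : MvPolynomial (Fin n) ℂ,
    ∀ μ : Measure (EuclideanSpace ℝ (Fin n)), Represents μ y →
      eLpNorm (fun x => evc p x * f x - evc q x) 2 μ ≤ ENNReal.ofReal ε

variable {y : (Fin n → ℕ) → ℝ}

lemma Gp_const (c : ℂ) : Gp y (BoundedContinuousFunction.const _ c) := by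
  intro p ε hε
  refine ⟨p * C c, fun μ h => ?_⟩
  have : (fun x => evc p x * (BoundedContinuousFunction.const (EuclideanSpace ℝ (Fin n)) c) x - evc (p * C c) x) = 0 := by
    funext x; simp [evc]
  rw [this]; simp

lemma Gp_add {f g} (hf : Gp y f) (hg : Gp y g) : Gp y (f + g) := by
  intro p ε hε
  obtain ⟨q1, h1⟩ := hf p (ε/2) (by positivity)
  obtain ⟨q2, h2⟩ := hg p (ε/2) (by positivity)
  refine ⟨q1 + q2, fun μ h => ?_⟩
  have : (fun x => evc p x * (f + g) x - evc (q1 + q2) x) =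
    (fun x => evc p x * f x - evc q1 x) + (fun x => evc p x * g x - evc q2 x) := by
    funext x; simp [evc]; ring
  rw [this]
  have c1 := ((evc_cont p).mul f.continuous).sub (evc_cont q1)
  have c2 := ((evc_cont p).mul g.continuous).sub (evc_cont q2)
  refine (eLpNorm_add_le c1.aestronglyMeasurable c2.aestronglyMeasurable (by norm_num)).trans ?_
  refine (add_le_add (h1 μ h) (h2 μ h)).trans ?_
  rw [← ENNReal.ofReal_add (by positivity) (by positivity)]
  simp

lemma Gp_mul {f g} (hf : Gp y f) (hg : Gp y g) : Gp y (f * g) := by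
  intro p ε hε
  have hN : 0 < ‖g‖ + 1 := by positivity
  obtain ⟨q1, h1⟩ := hf p (ε/2/(‖g‖+1)) (by positivity)
  obtain ⟨q2, h2⟩ := hg q1 (ε/2) (by positivity)
  refine ⟨q2, fun μ h => ?_⟩
  have : (fun x => evc p x * (f * g) x - evc q2 x) =
    (fun x => (evc p x * f x - evc q1 x) * g x) + (fun x => evc q1 x * g x - evc q2 x) := by
    funext x; simp; ring
  rw [this]
  have c1 := (((evc_cont p).mul f.continuous).sub (evc_cont q1)).mul g.continuous
  have c2 := ((evc_cont q1).mul g.continuous).sub (evc_cont q2)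
  refine (eLpNorm_add_le c1.aestronglyMeasurable c2.aestronglyMeasurable (by norm_num)).trans ?_
  have h3 : eLpNorm (fun x => (evc p x * f x - evc q1 x) * g x) 2 μ ≤
      ENNReal.ofReal (‖g‖+1) * eLpNorm (fun x => evc p x * f x - evc q1 x) 2 μ := by
    refine eLpNorm_le_mul_eLpNorm_of_ae_le_mul (ae_of_all _ fun x => ?_) 2
    rw [norm_mul, mul_comm]
    exact mul_le_mul_of_nonneg_right ((g.norm_coe_le_norm x).trans (by linarith)) (norm_nonneg _)
  have h4 : ENNReal.ofReal (‖g‖+1) * eLpNorm (fun x => evc p x * f x - evc q1 x) 2 μ ≤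
      ENNReal.ofReal (ε/2) := by
    refine (mul_le_mul_right (h1 μ h) _).trans ?_
    rw [← ENNReal.ofReal_mul (by positivity)]
    refine le_of_eq ?_
    congr 1
    field_simp
  refine (add_le_add (h3.trans h4) (h2 μ h)).trans ?_
  rw [← ENNReal.ofReal_add (by positivity) (by positivity)]
  simp

lemma norm_sub_ge (t : ℝ) {c : ℂ} (hc : |c.im| = 1) : 1 ≤ ‖(t : ℂ) - c‖ := by
  have := Complex.abs_im_le_norm ((t : ℂ) - c)
  simpa [hc] using this

/-- resolvent functions -/
def rsv (j : Fin n) (c : ℂ) (hc : |c.im| = 1) :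
    BoundedContinuousFunction (EuclideanSpace ℝ (Fin n)) ℂ :=
  BoundedContinuousFunction.ofNormedAddCommGroup (fun x => (((x j : ℝ) : ℂ) - c)⁻¹)
    (by
      refine Continuous.inv₀ ((Complex.continuous_ofReal.comp (by fun_prop)).sub continuous_const) ?_
      intro x h0
      have := norm_sub_ge (x j) hc
      rw [h0] at this; simp at this; linarith) 1
    (by
      intro x
      rw [norm_inv]
      exact inv_le_one_of_one_le₀ (norm_sub_ge (x j) hc))

lemma Gp_rsv (hd : Dens y) (j : Fin n) (c : ℂ) (hc : |c.im| = 1) : Gp y (rsv j c hc) := by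
  intro p ε hε
  obtain ⟨q0, hq⟩ := hd j c hc p (ε^2) (by positivity)
  set q := q0 * p
  refine ⟨q, fun μ h => ?_⟩
  have h1 := rep_norm h (p - (X j - C c) * q)
  have h2 : eLpNorm (evc (p - (X j - C c) * q)) 2 μ ≤ ENNReal.ofReal ε := by
    have : eLpNorm (evc (p - (X j - C c) * q)) 2 μ ^ 2 ≤ ENNReal.ofReal ε ^ 2 := by
      rw [h1, ← ENNReal.ofReal_pow hε.le]
      exact ENNReal.ofReal_le_ofReal hq.le
    exact (ENNReal.pow_le_pow_left_iff (by norm_num)).1 this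
  refine le_trans (eLpNorm_mono fun x => ?_) h2
  have hx := norm_sub_ge (x j) hc
  have hx0 : ((x j : ℝ) : ℂ) - c ≠ 0 := by
    intro h0; rw [h0] at hx; simp at hx; linarith
  have e1 : evc (p - (X j - C c) * q) x = (((x j : ℝ) : ℂ) - c) * (evc p x * (rsv j c hc) x - evc q x) := by
    have : (rsv j c hc) x = (((x j : ℝ) : ℂ) - c)⁻¹ := rfl
    rw [this]
    simp only [evc, map_sub, map_mul, eval_X, eval_C]
    field_simp
  rw [e1, norm_mul]
  exact le_mul_of_one_le_left (norm_nonneg _) hx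

/-- the algebra of good functions -/
def GA (y : (Fin n → ℕ) → ℝ) : StarSubalgebra ℂ (BoundedContinuousFunction (EuclideanSpace ℝ (Fin n)) ℂ) where
  carrier := {f | Gp y f ∧ Gp y (star f)}
  mul_mem' := by
    rintro f g ⟨hf, hf'⟩ ⟨hg, hg'⟩
    exact ⟨Gp_mul hf hg, by rw [star_mul]; exact Gp_mul hg' hf'⟩
  add_mem' := by
    rintro f g ⟨hf, hf'⟩ ⟨hg, hg'⟩
    exact ⟨Gp_add hf hg, by rw [star_add]; exact Gp_add hf' hg'⟩
  algebraMap_mem' := by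
    intro c
    refine ⟨Gp_const c, ?_⟩
    have : star (algebraMap ℂ (BoundedContinuousFunction (EuclideanSpace ℝ (Fin n)) ℂ) c) =
      BoundedContinuousFunction.const _ (star c) := by
      ext x; rfl
    rw [this]
    exact Gp_const _
  star_mem' := by
    rintro f ⟨hf, hf'⟩
    exact ⟨hf', by rw [star_star]; exact hf⟩

lemma rsv_mem (hd : Dens y) (j : Fin n) (c : ℂ) (hc : |c.im| = 1) : rsv j c hc ∈ GA y := by
  refine ⟨Gp_rsv hd j c hc, ?_⟩
  have hc' : |(star c).im| = 1 := by simpa using hc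
  have : star (rsv j c hc) = rsv j (star c) hc' := by
    ext x
    change star ((((x j : ℝ) : ℂ) - c)⁻¹) = (((x j : ℝ) : ℂ) - star c)⁻¹
    simp
  rw [this]
  exact Gp_rsv hd j _ hc'

lemma GA_int {μ ν : Measure (EuclideanSpace ℝ (Fin n))} (hμ : Represents μ y) (hν : Represents ν y)
    {f} (hf : f ∈ GA y) : ∫ x, f x ∂μ = ∫ x, f x ∂ν := by
  have := (rep_univ hμ).2
  have := (rep_univ hν).2
  set K : ℝ := Real.sqrt (y 0) with hK
  have key : ∀ χ : Measure (EuclideanSpace ℝ (Fin n)), Represents χ y → ∀ ε : ℝ, 0 < ε →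
      ∀ q : MvPolynomial (Fin n) ℂ, eLpNorm (fun x => evc 1 x * f x - evc q x) 2 χ ≤ ENNReal.ofReal ε →
      ‖∫ x, f x ∂χ - Lc y q‖ ≤ ε * K := by
    intro χ hχ ε hε q hq
    have := (rep_univ hχ).2
    have e1 : (fun x => evc 1 x * f x - evc q x) = fun x => f x - evc q x := by
      funext x; simp [evc]
    rw [e1] at hq
    rw [← (rep_int hχ q).2, ← integral_sub (f.integrable χ) (rep_int hχ q).1]
    have c1 := f.continuous.sub (evc_cont q)
    have h1 := eLpNorm_le_eLpNorm_mul_rpow_measure_univ (μ := χ) (p := 1) (q := 2) (by norm_num)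
      (c1.aestronglyMeasurable)
    rw [eLpNorm_one_eq_lintegral_enorm, (rep_univ hχ).1] at h1
    have h2 : ENNReal.ofReal (y 0) ^ (1 / (1:ℝ≥0∞).toReal - 1/(2:ℝ≥0∞).toReal) = ENNReal.ofReal K := by
      rw [hK, Real.sqrt_eq_rpow, ← ENNReal.ofReal_rpow_of_nonneg _ (by norm_num)]
      · norm_num
      · have := (hχ 0).2
        rw [← this]
        exact integral_nonneg fun x => by simp [monom]
    rw [h2] at h1
    have h3 := h1.trans (mul_le_mul_left hq _)
    rw [← ENNReal.ofReal_mul hε.le] at h3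
    have h4 := (enorm_integral_le_lintegral_enorm (μ := χ) (fun x => f x - evc q x)).trans h3
    rw [← ofReal_norm] at h4
    exact (ENNReal.ofReal_le_ofReal_iff (by positivity)).1 h4
  have h : ∀ ε : ℝ, 0 < ε → ‖∫ x, f x ∂μ - ∫ x, f x ∂ν‖ ≤ ε := by
    intro ε hε
    have hK0 : 0 ≤ K := Real.sqrt_nonneg _
    obtain ⟨q, hq⟩ := hf.1 1 (ε / (2 * (K + 1))) (by positivity)
    have a1 := key μ hμ _ (by positivity) q (hq μ hμ)
    have a2 := key ν hν _ (by positivity) q (hq ν hν)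
    have a3 : ε / (2 * (K + 1)) * K ≤ ε / 2 := by
      rw [div_mul_eq_mul_div, div_le_div_iff₀ (by positivity) (by norm_num)]
      nlinarith
    calc _ = ‖(∫ x, f x ∂μ - Lc y q) - (∫ x, f x ∂ν - Lc y q)‖ := by congr 1; ring
      _ ≤ _ := norm_sub_le _ _
      _ ≤ ε := by linarith
  have := le_of_forall_pos_le_add (a := ‖∫ x, f x ∂μ - ∫ x, f x ∂ν‖) (b := 0) (by simpa using h)
  exact sub_eq_zero.1 (norm_le_zero_iff.1 this)

theorem rep_unique (hd : Dens y) {μ ν : Measure (EuclideanSpace ℝ (Fin n))}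
    (hμ : Represents μ y) (hν : Represents ν y) : μ = ν := by
  have := (rep_univ hμ).2
  have := (rep_univ hν).2
  refine ext_of_forall_mem_subalgebra_integral_eq_of_pseudoEMetric_complete_countable (𝕜 := ℂ)
    (A := GA y) ?_ (fun g hg => GA_int hμ hν hg)
  intro x x' hne
  have : ∃ j, x j ≠ x' j := by
    by_contra hcon
    push Not at hcon
    exact hne (by ext j; exact hcon j)
  obtain ⟨j, hj⟩ := this
  refine ⟨_, ⟨_, ⟨rsv j Complex.I (by simp), rsv_mem hd j _ _, rfl⟩, rfl⟩, ?_⟩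
  change (((x j : ℝ) : ℂ) - Complex.I)⁻¹ ≠ (((x' j : ℝ) : ℂ) - Complex.I)⁻¹
  intro h
  rw [inv_inj] at h
  apply hj
  have := sub_left_injective h
  exact_mod_cast this

end

open scoped InnerProductSpace in
theorem spec_calc {H : Type} [NormedAddCommGroup H] [InnerProductSpace ℂ H] [CompleteSpace H]
    {I : Type*} (T : I → H →L[ℂ] H) (hcomm : ∀ a b, T a * T b = T b * T a)
    (hstar : ∀ a b, T a * star (T b) = star (T b) * T a) :
    ∃ (K : Type) (_ : TopologicalSpace K) (_ : CompactSpace K) (_ : T2Space K)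
      (Θ : C(K, ℂ) →⋆ₐ[ℂ] (H →L[ℂ] H)) (r : I → C(K, ℂ)),
      Function.Injective Θ ∧ ∀ a, Θ (r a) = T a := by
  set s : Set (H →L[ℂ] H) := Set.range T with hs
  have hc : IsMulCommutative (StarAlgebra.adjoin ℂ s) := by
    refine StarAlgebra.isMulCommutative_adjoin ℂ ?_ ?_
    · rintro _ ⟨a, rfl⟩ _ ⟨b, rfl⟩; exact hcomm a b
    · rintro _ ⟨a, rfl⟩ _ ⟨b, rfl⟩
      exact hstar a b
  set A := (StarAlgebra.adjoin ℂ s).topologicalClosure with hA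
  have hcl : IsClosed (A : Set (H →L[ℂ] H)) := StarSubalgebra.isClosed_topologicalClosure _
  let inst : CommCStarAlgebra A :=
    { StarSubalgebra.cstarAlgebra A (h_closed := hcl) with
      mul_comm := (StarSubalgebra.commRingTopologicalClosure (StarAlgebra.adjoin ℂ s)
        (fun x y => hc.is_comm.comm x y)).mul_comm }
  let Γ := gelfandStarTransform A
  refine ⟨WeakDual.characterSpace ℂ A, inferInstance, inferInstance, inferInstance,
    A.subtype.comp (Γ.symm : C(WeakDual.characterSpace ℂ A, ℂ) →⋆ₐ[ℂ] A),
    fun a => Γ ⟨T a, StarSubalgebra.le_topologicalClosure _ (StarAlgebra.subset_adjoin ℂ s ⟨a, rfl⟩)⟩, ?_, fun a => ?_⟩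
  · exact Subtype.val_injective.comp Γ.symm.injective
  simp

theorem spec_meas {H : Type} [NormedAddCommGroup H] [InnerProductSpace ℂ H] [CompleteSpace H]
    {K : Type} [TopologicalSpace K] [CompactSpace K] [T2Space K] [MeasurableSpace K] [BorelSpace K]
    (Θ : C(K, ℂ) →⋆ₐ[ℂ] (H →L[ℂ] H)) (v : H) :
    ∃ ν : Measure K, IsFiniteMeasure ν ∧ ∀ f : C(K, ℂ), ∫ x, ‖f x‖^2 ∂ν = ‖Θ f v‖^2 := by
  let J : C(K, ℝ) →ₗ[ℝ] C(K, ℂ) :=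
    { toFun := fun f => ⟨fun x => (f x : ℂ), by fun_prop⟩
      map_add' := fun f g => by ext x; simp
      map_smul' := fun c f => by ext x; simp }
  have hJ : ∀ f x, J f x = (f x : ℂ) := fun _ _ => rfl
  have hsq : ∀ f : C(K, ℂ), inner ℂ v (Θ (star f * f) v) = (‖Θ f v‖^2 : ℝ) := by
    intro f
    rw [map_mul, map_star, mul_apply_eq_comp, ContinuousLinearMap.star_eq_adjoint,
      ContinuousLinearMap.adjoint_inner_right, inner_self_eq_norm_sq_to_K]
    simp
  let Λ0 : CompactlySupportedContinuousMap K ℝ →ₗ[ℝ] ℝ :=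
    { toFun := fun f => (inner ℂ v (Θ (J f.toContinuousMap) v)).re
      map_add' := fun f g => by
        rw [show (f + g).toContinuousMap = f.toContinuousMap + g.toContinuousMap from rfl]
        simp
      map_smul' := fun c f => by
        rw [show (c • f).toContinuousMap = c • f.toContinuousMap from rfl]
        rw [map_smul, show c • J f.toContinuousMap = (c : ℂ) • J f.toContinuousMap from by ext x; simp,
          map_smul]
        simp }
  have key : ∀ g : C(K, ℂ), ∀ f : CompactlySupportedContinuousMap K ℝ, (∀ x, f x = ‖g x‖^2) →
      Λ0 f = ‖Θ g v‖^2 := by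
    intro g f h
    have : J f.toContinuousMap = star g * g := by
      ext x
      rw [hJ]
      change ((f x : ℝ) : ℂ) = star (g x) * g x
      rw [h, mul_comm, Complex.star_def, Complex.mul_conj, Complex.normSq_eq_norm_sq]
    change (inner ℂ v (Θ (J f.toContinuousMap) v)).re = _
    rw [this, hsq, Complex.ofReal_re]
  let Λ : CompactlySupportedContinuousMap K ℝ →ₚ[ℝ] ℝ := PositiveLinearMap.mk₀ Λ0 (by
    intro f hf
    rw [key ⟨fun x => (Real.sqrt (f x) : ℂ), by fun_prop⟩ f]
    · positivity
    · intro x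
      have : 0 ≤ f x := hf x
      simp [Real.sq_sqrt this])
  refine ⟨RealRMK.rieszMeasure Λ, ?_, fun f => ?_⟩
  · infer_instance
  · have := RealRMK.integral_rieszMeasure Λ
      (CompactlySupportedContinuousMap.continuousMapEquiv ⟨fun x => ‖f x‖^2, by fun_prop⟩)
    refine this.trans ?_
    exact key f _ (fun x => rfl)

section
variable {n : ℕ} {y : (Fin n → ℕ) → ℝ} {H : Type} [NormedAddCommGroup H] [InnerProductSpace ℂ H]
  [CompleteSpace H] {ι : MvPolynomial (Fin n) ℂ →ₗ[ℂ] H}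

lemma gns_norm (hι : ∀ p q, inner ℂ (ι p) (ι q) = Lc y (cj p * q)) (p) :
    ‖ι p‖^2 = (Lc y (cj p * p)).re := by
  have := inner_self_eq_norm_sq (𝕜 := ℂ) (ι p)
  rw [← this, hι]; rfl

/-- linear factor -/
def sg (j : Fin n) (c : ℂ) : MvPolynomial (Fin n) ℂ := X j - C c

lemma cj_sg (j : Fin n) (c : ℂ) : cj (sg j c) = sg j (star c) := by
  simp [cj, sg]

lemma sg_approx (hι : ∀ p q, inner ℂ (ι p) (ι q) = Lc y (cj p * q)) (hd : Dens y)
    (j : Fin n) (c : ℂ) (hc : |c.im| = 1) (p) (ε : ℝ) (hε : 0 < ε) :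
    ∃ g, ‖ι p - ι (sg j c * (g * p))‖ < ε := by
  obtain ⟨g, hg⟩ := hd j c hc p (ε^2) (by positivity)
  refine ⟨g, ?_⟩
  rw [← gns_norm hι, map_sub] at hg
  exact lt_of_pow_lt_pow_left₀ 2 hε.le hg

lemma sg_bound (hι : ∀ p q, inner ℂ (ι p) (ι q) = Lc y (cj p * q))
    (j : Fin n) (c : ℂ) (hc : |c.im| = 1) (q) : ‖ι q‖ ≤ ‖ι (sg j c * q)‖ := by
  refine le_of_sq_le_sq ?_ (norm_nonneg _)
  have hre : cj (sg j (c.re : ℂ)) = sg j (c.re : ℂ) := by rw [cj_sg]; simp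
  have e : cj (sg j c * q) * (sg j c * q) =
      cj (sg j (c.re : ℂ) * q) * (sg j (c.re : ℂ) * q) + cj q * q := by
    rw [map_mul, map_mul, hre, cj_sg]
    have h1 : sg j (star c) * sg j c = sg j (c.re : ℂ) * sg j (c.re : ℂ) + 1 := by
      have h2 : star c + c = c.re + c.re := by
        apply Complex.ext <;> simp
      have h3 : star c * c = c.re * c.re + 1 := by
        have : c.im * c.im = 1 := by rw [← abs_mul_abs_self, hc, one_mul]
        apply Complex.ext <;> simp
        · linarith
        · ring
      have h4 := congrArg (C : ℂ → MvPolynomial (Fin n) ℂ) h2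
      have h5 := congrArg (C : ℂ → MvPolynomial (Fin n) ℂ) h3
      simp only [C_add, C_mul, C_1] at h4 h5
      unfold sg
      linear_combination h5 - X j * h4
    linear_combination (cj q * q) * h1
  rw [gns_norm hι, gns_norm hι, e, map_add, Complex.add_re, ← gns_norm hι (sg j (c.re : ℂ) * q)]
  nlinarith [norm_nonneg (ι (sg j (c.re : ℂ) * q))]

lemma sg_dense (hι : ∀ p q, inner ℂ (ι p) (ι q) = Lc y (cj p * q))
    (hd : Dens y) (j : Fin n) (c : ℂ) (hc : |c.im| = 1) (a : MvPolynomial (Fin n) ℂ)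
    (ha : DenseRange (fun q => ι (a * q))) : DenseRange (fun q => ι (sg j c * a * q)) := by
  rw [Metric.denseRange_iff] at ha ⊢
  intro x r hr
  obtain ⟨p, hp⟩ := ha x (r/2) (by positivity)
  obtain ⟨g, hg⟩ := sg_approx hι hd j c hc (a * p) (r/2) (by positivity)
  refine ⟨g * p, ?_⟩
  have : sg j c * a * (g * p) = sg j c * (g * (a * p)) := by ring
  rw [this]
  rw [← dist_eq_norm] at hg
  linarith [dist_triangle x (ι (a * p)) (ι (sg j c * (g * (a * p))))]

theorem exists_resolvents (hdense : DenseRange ι)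
    (hι : ∀ p q, inner ℂ (ι p) (ι q) = Lc y (cj p * q)) (hd : Dens y) :
    ∃ R : Fin n × {c : ℂ // |c.im| = 1} → H →L[ℂ] H,
      (∀ a q, R a (ι (sg a.1 a.2 * q)) = ι q) ∧ (∀ a b, R a * R b = R b * R a) ∧
      (∀ j, star (R (j, ⟨Complex.I, by simp⟩)) = R (j, ⟨-Complex.I, by simp⟩)) := by
  have hd1 : DenseRange (fun q => ι (1 * q)) := by simpa using hdense
  let e : Fin n × {c : ℂ // |c.im| = 1} → MvPolynomial (Fin n) ℂ →ₗ[ℂ] H :=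
    fun a => ι ∘ₗ LinearMap.mulLeft ℂ (sg a.1 a.2)
  have he : ∀ a q, e a q = ι (sg a.1 a.2 * q) := fun _ _ => rfl
  have hed : ∀ a, DenseRange (e a) := by
    intro a
    have := sg_dense hι hd a.1 a.2 a.2.2 1 hd1
    simp only [mul_one] at this
    exact this
  have hR : ∀ a q, ι.extendOfNorm (e a) (ι (sg a.1 a.2 * q)) = ι q := by
    intro a q
    exact LinearMap.extendOfNorm_eq (hed a)
      ⟨1, fun q => by rw [one_mul]; exact sg_bound hι a.1 a.2 a.2.2 q⟩ q
  refine ⟨fun a => ι.extendOfNorm (e a), hR, fun a b => ?_, fun j => ?_⟩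
  · have hdd : DenseRange (fun q => ι (sg a.1 a.2 * (sg b.1 b.2) * q)) :=
      sg_dense hι hd a.1 a.2 a.2.2 _ (hed b)
    ext x
    have hcl : IsClosed {x | (ι.extendOfNorm (e a) * ι.extendOfNorm (e b)) x =
      (ι.extendOfNorm (e b) * ι.extendOfNorm (e a)) x} :=
      isClosed_eq (ContinuousLinearMap.continuous _) (ContinuousLinearMap.continuous _)
    refine hdd.induction_on x hcl fun q => ?_
    change ι.extendOfNorm (e a) (ι.extendOfNorm (e b) (ι (sg a.1 a.2 * (sg b.1 b.2) * q))) =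
      ι.extendOfNorm (e b) (ι.extendOfNorm (e a) (ι (sg a.1 a.2 * (sg b.1 b.2) * q)))
    rw [mul_assoc, hR a, hR b, mul_left_comm, hR b, hR a]
  · set a : Fin n × {c : ℂ // |c.im| = 1} := (j, ⟨Complex.I, by simp⟩) with ha
    set b : Fin n × {c : ℂ // |c.im| = 1} := (j, ⟨-Complex.I, by simp⟩) with hb
    have hab : cj (sg b.1 b.2) = sg a.1 a.2 := by
      rw [cj_sg]; simp [hb, ha]
    rw [ContinuousLinearMap.star_eq_adjoint]
    symm
    rw [ContinuousLinearMap.eq_adjoint_iff]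
    intro u w
    refine DenseRange.induction_on (hed b) u (isClosed_eq (by fun_prop) (by fun_prop)) fun p => ?_
    refine DenseRange.induction_on (hed a) w (isClosed_eq (by fun_prop) (by fun_prop)) fun q => ?_
    rw [he, he, hR, hR, hι, hι, map_mul cj, hab]
    congr 1; ring

theorem exists_resolvents' (hdense : DenseRange ι)
    (hι : ∀ p q, inner ℂ (ι p) (ι q) = Lc y (cj p * q)) (hd : Dens y) :
    ∃ T : Fin n → H →L[ℂ] H,
      (∀ j q, T j (ι (sg j Complex.I * q)) = ι q) ∧ (∀ a b, T a * T b = T b * T a) ∧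
      (∀ a b, T a * star (T b) = star (T b) * T a) ∧
      (∀ j, T j - star (T j) = (2 * Complex.I) • (star (T j) * T j)) := by
  obtain ⟨R, h1, h2, h3⟩ := exists_resolvents hdense hι hd
  refine ⟨fun j => R (j, ⟨Complex.I, by simp⟩), fun j q => h1 (j, ⟨Complex.I, by simp⟩) q,
    fun a b => h2 _ _, fun a b => by rw [h3]; exact h2 _ _, fun j => ?_⟩
  rw [h3]
  set a : Fin n × {c : ℂ // |c.im| = 1} := (j, ⟨Complex.I, by simp⟩) with ha
  set b : Fin n × {c : ℂ // |c.im| = 1} := (j, ⟨-Complex.I, by simp⟩) with hb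
  have hdd : DenseRange (fun q => ι (sg a.1 a.2 * (sg b.1 b.2 * 1) * q)) :=
    sg_dense hι hd a.1 a.2 a.2.2 _ (by
      have := sg_dense hι hd b.1 b.2 b.2.2 1 (by simpa using hdense)
      exact this)
  ext x
  refine hdd.induction_on x (isClosed_eq (ContinuousLinearMap.continuous _)
    (ContinuousLinearMap.continuous _)) fun q => ?_
  change R a _ - R b _ = (2 * Complex.I) • (R b (R a _))
  rw [mul_one, mul_assoc, h1 a, h1 b, mul_left_comm, h1 b, ← map_sub, ← map_smul]
  congr 1
  simp only [sg, ha, hb, smul_eq_C_mul, C_mul, C_neg]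
  rw [show (C (2:ℂ) : MvPolynomial (Fin n) ℂ) = 2 from rfl]
  ring
end

section
variable {n : ℕ} {y : (Fin n → ℕ) → ℝ} {H : Type} [NormedAddCommGroup H] [InnerProductSpace ℂ H]
  [CompleteSpace H] {ι : MvPolynomial (Fin n) ℂ →ₗ[ℂ] H}
  {K : Type} [TopologicalSpace K] [CompactSpace K] [T2Space K] [MeasurableSpace K] [BorelSpace K]

/-- joint coordinates -/
def coordK (r : Fin n → C(K, ℂ)) (k : K) : EuclideanSpace ℝ (Fin n) :=
  WithLp.toLp 2 (fun j => ((r j k)⁻¹ + Complex.I).re)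

lemma coordK_meas (r : Fin n → C(K, ℂ)) : Measurable (coordK r) := by
  refine (MeasurableEquiv.toLp 2 (Fin n → ℝ)).measurable.comp ?_
  refine measurable_pi_lambda _ fun j => ?_
  exact Complex.measurable_re.comp (((r j).continuous.measurable.inv).add_const _)

lemma coordK_real (r : Fin n → C(K, ℂ))
    (hr : ∀ j, r j - star (r j) = (2 * Complex.I) • (star (r j) * r j)) (j : Fin n) (k : K)
    (h : r j k ≠ 0) : ((coordK r k j : ℝ) : ℂ) * r j k = 1 + Complex.I * r j k := by
  have h1 : r j k - star (r j k) = (2 * Complex.I) * (star (r j k) * r j k) :=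
    congrArg (fun f : C(K, ℂ) => f k) (hr j)
  have h2 : star (r j k) ≠ 0 := by simpa using h
  have h3 : (starRingEnd ℂ) ((r j k)⁻¹ + Complex.I) = (r j k)⁻¹ + Complex.I := by
    rw [map_add, map_inv₀, Complex.conj_I]
    change (star (r j k))⁻¹ + _ = _
    field_simp
    linear_combination h1
  have h4 : ((coordK r k j : ℝ) : ℂ) = (r j k)⁻¹ + Complex.I := Complex.conj_eq_iff_re.1 h3
  rw [h4]; field_simp

lemma calc_poly (Θ : C(K, ℂ) →⋆ₐ[ℂ] (H →L[ℂ] H)) (r : Fin n → C(K, ℂ))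
    (hr : ∀ j, r j - star (r j) = (2 * Complex.I) • (star (r j) * r j))
    (hT : ∀ j q, Θ (r j) (ι (sg j Complex.I * q)) = ι q) (p : MvPolynomial (Fin n) ℂ) :
    ∃ (m : ℕ) (F : C(K, ℂ)), Θ ((∏ j, r j) ^ m) (ι p) = Θ F (ι 1) ∧
      ∀ k, (∏ j, r j k) ≠ 0 → F k = evc p (coordK r k) * (∏ j, r j k) ^ m := by
  induction p using MvPolynomial.induction_on with
  | C a =>
    refine ⟨0, algebraMap ℂ _ a, ?_, fun k _ => by simp [evc]⟩
    rw [pow_zero, map_one, AlgHomClass.commutes, ← mul_one (C a), ← smul_eq_C_mul, map_smul]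
    rfl
  | add p q hp hq =>
    obtain ⟨m1, F1, h1, h1'⟩ := hp
    obtain ⟨m2, F2, h2, h2'⟩ := hq
    refine ⟨m1 + m2, (∏ j, r j)^m2 * F1 + (∏ j, r j)^m1 * F2, ?_, fun k hk => ?_⟩
    · rw [map_add ι, map_add (Θ _), map_add Θ, add_apply, map_mul Θ, map_mul Θ,
        mul_apply_eq_comp, mul_apply_eq_comp, ← h1, ← h2,
        ← mul_apply_eq_comp, ← mul_apply_eq_comp, ← map_mul, ← map_mul, ← pow_add, ← pow_add,
        add_comm m2 m1]
    · have e : evc (p + q) (coordK r k) = evc p (coordK r k) + evc q (coordK r k) := by simp [evc]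
      rw [e]
      simp only [ContinuousMap.add_apply, ContinuousMap.mul_apply, ContinuousMap.pow_apply,
        ContinuousMap.prod_apply]
      rw [h1' k hk, h2' k hk]; ring
  | mul_X p j hp =>
    obtain ⟨m, F, h, h'⟩ := hp
    set ρ' : C(K, ℂ) := ∏ i ∈ Finset.univ.erase j, r i with hρ'
    have hρ : r j * ρ' = ∏ i, r i := Finset.mul_prod_erase _ _ (Finset.mem_univ j)
    refine ⟨m + 1, ρ' * (1 + Complex.I • r j) * F, ?_, fun k hk => ?_⟩
    · have e1 : Θ (r j) (ι (p * X j)) = Θ (1 + Complex.I • r j) (ι p) := by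
        have : p * X j = sg j Complex.I * p + Complex.I • p := by
          rw [sg, smul_eq_C_mul]; ring
        rw [this, map_add, map_add, hT, map_add Θ, map_one, map_smul, map_smul, map_smul]
        rfl
      rw [map_mul Θ _ F, mul_apply_eq_comp, ← h, ← mul_apply_eq_comp, ← map_mul]
      have e2 : ρ' * (1 + Complex.I • r j) * (∏ j, r j)^m =
        (ρ' * (∏ j, r j)^m) * (1 + Complex.I • r j) := by ring
      rw [e2, map_mul Θ _ (1 + Complex.I • r j), mul_apply_eq_comp, ← e1, ← mul_apply_eq_comp,
        ← map_mul, pow_succ]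
      congr 2
      rw [← hρ]; ring
    · have hk' : (∏ i, r i k) = r j k * ρ' k := by
        rw [← ContinuousMap.mul_apply, hρ, ContinuousMap.prod_apply]
      have hj : r j k ≠ 0 := by
        intro h0; rw [hk', h0, zero_mul] at hk; exact hk rfl
      have e : evc (p * X j) (coordK r k) = evc p (coordK r k) * ((coordK r k j : ℝ) : ℂ) := by
        simp [evc]
      have e3 := coordK_real r hr j k hj
      simp only [ContinuousMap.mul_apply, ContinuousMap.add_apply, ContinuousMap.one_apply,
        ContinuousMap.smul_apply, smul_eq_mul]
      rw [h' k hk, e, pow_succ, hk']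
      linear_combination (-(ρ' k) * evc p (coordK r k) * (r j k * ρ' k)^m) * e3

lemma calc_range (Θ : C(K, ℂ) →⋆ₐ[ℂ] (H →L[ℂ] H)) (r : Fin n → C(K, ℂ))
    (hT : ∀ j q, Θ (r j) (ι (sg j Complex.I * q)) = ι q) (p : MvPolynomial (Fin n) ℂ) (m : ℕ) :
    ∃ q, Θ ((∏ j, r j) ^ m) (ι q) = ι p := by
  have h1 : ∀ (s : Finset (Fin n)) p, ∃ q, Θ (∏ j ∈ s, r j) (ι q) = ι p := by
    intro s
    induction s using Finset.induction_on with
    | empty => intro p; exact ⟨p, by simp⟩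
    | insert j s hj ih =>
      intro p
      obtain ⟨q, hq⟩ := ih (sg j Complex.I * p)
      refine ⟨q, ?_⟩
      rw [Finset.prod_insert hj, map_mul, mul_apply_eq_comp, hq, hT]
  induction m generalizing p with
  | zero => exact ⟨p, by simp⟩
  | succ m ih =>
    obtain ⟨q, hq⟩ := ih p
    obtain ⟨q', hq'⟩ := h1 Finset.univ q
    exact ⟨q', by rw [pow_succ, map_mul, mul_apply_eq_comp, hq', hq]⟩

/-- regularised inverse -/
def reg (g : C(K, ℂ)) (N : ℕ) : C(K, ℂ) :=
  ⟨fun k => star (g k) * (((‖g k‖^2 + (1/((N:ℝ)+1))^2)⁻¹ : ℝ) : ℂ), by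
    refine (by fun_prop : Continuous fun k => star (g k)).mul (Complex.continuous_ofReal.comp ?_)
    refine Continuous.inv₀ (by fun_prop) fun k => ?_
    positivity⟩

lemma reg_mul (g : C(K, ℂ)) (N : ℕ) (k : K) :
    reg g N k * g k = ((‖g k‖^2 / (‖g k‖^2 + (1/((N:ℝ)+1))^2) : ℝ) : ℂ) := by
  change star (g k) * (((‖g k‖^2 + (1/((N:ℝ)+1))^2)⁻¹ : ℝ) : ℂ) * g k = _
  have : star (g k) * g k = ((‖g k‖^2 : ℝ) : ℂ) := by
    rw [mul_comm, Complex.star_def, Complex.mul_conj, Complex.normSq_eq_norm_sq]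
  rw [div_eq_mul_inv (‖g k‖^2), Complex.ofReal_mul, ← this]; ring

lemma reg_norm (g : C(K, ℂ)) (N : ℕ) : ‖reg g N * g * g - g‖ ≤ 1/((N:ℝ)+1) := by
  set ε : ℝ := 1/((N:ℝ)+1) with hε
  have hε0 : 0 < ε := by positivity
  rw [ContinuousMap.norm_le _ hε0.le]
  intro k
  simp only [ContinuousMap.sub_apply, ContinuousMap.mul_apply]
  rw [reg_mul, ← hε]
  have : ((‖g k‖^2 / (‖g k‖^2 + ε^2) : ℝ) : ℂ) * g k - g k =
      ((- ε^2 / (‖g k‖^2 + ε^2) : ℝ) : ℂ) * g k := by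
    have e : -ε^2 / (‖g k‖^2 + ε^2) = ‖g k‖^2 / (‖g k‖^2 + ε^2) - 1 := by
      field_simp; ring
    rw [e]; push_cast; ring
  rw [this, norm_mul, Complex.norm_real, Real.norm_eq_abs, neg_div, abs_neg,
    abs_of_nonneg (by positivity), div_mul_eq_mul_div, div_le_iff₀ (by positivity)]
  have : 0 ≤ ‖g k‖ := norm_nonneg _
  nlinarith [sq_nonneg (‖g k‖ - ε), mul_nonneg hε0.le this, mul_nonneg hε0.le (sq_nonneg (‖g k‖ - ε)), mul_nonneg (mul_nonneg hε0.le hε0.le) this]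

lemma calc_norm (Θ : C(K, ℂ) →⋆ₐ[ℂ] (H →L[ℂ] H)) (r : Fin n → C(K, ℂ))
    (hr : ∀ j, r j - star (r j) = (2 * Complex.I) • (star (r j) * r j))
    (hT : ∀ j q, Θ (r j) (ι (sg j Complex.I * q)) = ι q) (ν : Measure K) [IsFiniteMeasure ν]
    (hν : ∀ f : C(K, ℂ), ∫ x, ‖f x‖^2 ∂ν = ‖Θ f (ι 1)‖^2)
    (p : MvPolynomial (Fin n) ℂ) :
    ∫⁻ k in {k | (∏ j, r j k) ≠ 0}, ENNReal.ofReal (‖evc p (coordK r k)‖^2) ∂ν =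
      ENNReal.ofReal (‖ι p‖^2) := by
  set U : Set K := {k | (∏ j, r j k) ≠ 0} with hU
  have hUm : MeasurableSet U := by
    have : IsOpen U := isOpen_ne_fun (by fun_prop) continuous_const
    exact this.measurableSet
  obtain ⟨m, F0, h1, h2⟩ := calc_poly Θ r hr hT p
  set ρ : C(K, ℂ) := ∏ j, r j with hρ
  have hρk : ∀ k, ρ k = ∏ j, r j k := fun k => by rw [hρ, ContinuousMap.prod_apply]
  set g : C(K, ℂ) := ρ ^ (m+1) with hg
  set F : C(K, ℂ) := ρ * F0 with hF
  have hgk : ∀ k, g k = (∏ j, r j k)^(m+1) := fun k => by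
    rw [hg, ContinuousMap.pow_apply, hρk]
  have h3 : Θ g (ι p) = Θ F (ι 1) := by
    rw [hg, hF, pow_succ', map_mul, map_mul, mul_apply_eq_comp, mul_apply_eq_comp, h1]
  have h4 : ∀ k, k ∈ U → F k = evc p (coordK r k) * g k := by
    intro k hk
    rw [hF, ContinuousMap.mul_apply, h2 k hk, hgk, hρk]; ring
  have h5 : ∀ k, k ∉ U → g k = 0 := by
    intro k hk
    have : (∏ j, r j k) = 0 := by simpa [hU] using hk
    rw [hgk, this, zero_pow (by omega)]
  obtain ⟨q, hq0⟩ := calc_range Θ r hT p (m+1)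
  have hq : Θ g (ι q) = ι p := hq0
  -- the approximations converge
  have c1 : Tendsto (fun N => Θ (reg g N * F) (ι 1)) atTop (𝓝 (ι p)) := by
    rw [tendsto_iff_norm_sub_tendsto_zero]
    have ht : Tendsto (fun N : ℕ => 1/((N:ℝ)+1) * ‖ι q‖) atTop (𝓝 0) := by
      have := (tendsto_one_div_add_atTop_nhds_zero_nat (𝕜 := ℝ)).mul_const ‖ι q‖
      simpa using this
    refine squeeze_zero (fun _ => norm_nonneg _) (fun N => ?_) ht
    have e : Θ (reg g N * F) (ι 1) - ι p = Θ (reg g N * g * g - g) (ι q) := by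
      rw [map_sub, sub_apply, hq, map_mul, mul_apply_eq_comp, ← h3,
        map_mul Θ _ g, mul_apply_eq_comp, hq, map_mul Θ _ g, mul_apply_eq_comp]
    rw [e]
    refine (ContinuousLinearMap.le_opNorm _ _).trans ?_
    gcongr
    exact (NonUnitalStarAlgHom.norm_apply_le Θ _).trans (reg_norm g N)
  have c2 : Tendsto (fun N => ENNReal.ofReal (∫ k, ‖(reg g N * F) k‖^2 ∂ν)) atTop
      (𝓝 (ENNReal.ofReal (‖ι p‖^2))) := by
    refine ENNReal.tendsto_ofReal ?_
    simp only [hν]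
    exact (c1.norm).pow 2
  set G : ℕ → K → ℝ := fun N k => U.indicator
    (fun k => (‖g k‖^2 / (‖g k‖^2 + (1/((N:ℝ)+1))^2))^2 * ‖evc p (coordK r k)‖^2) k with hG
  have e1 : ∀ N k, ‖(reg g N * F) k‖^2 = G N k := by
    intro N k
    by_cases hk : k ∈ U
    · rw [hG]
      simp only [Set.indicator_of_mem hk]
      have : (reg g N * F) k = (reg g N k * g k) * evc p (coordK r k) := by
        rw [ContinuousMap.mul_apply, h4 k hk]; ring
      rw [this, reg_mul, norm_mul, Complex.norm_real, mul_pow, Real.norm_eq_abs, sq_abs]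
    · rw [hG]
      simp only [Set.indicator_of_notMem hk]
      have : reg g N k = 0 := by
        change star (g k) * _ = 0
        rw [h5 k hk]; simp
      rw [ContinuousMap.mul_apply, this]; simp
  have e2 : ∀ N, ENNReal.ofReal (∫ k, ‖(reg g N * F) k‖^2 ∂ν) = ∫⁻ k, ENNReal.ofReal (G N k) ∂ν := by
    intro N
    rw [ofReal_integral_eq_lintegral_ofReal]
    · simp only [e1]
    · have hc : Continuous fun k => ‖(reg g N * F) k‖^2 := by fun_prop
      exact hc.integrable_of_hasCompactSupport (HasCompactSupport.of_compactSpace _)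
    · exact ae_of_all _ fun k => by positivity
  simp only [e2] at c2
  have hGm : ∀ N, Measurable (G N) := by
    intro N
    have hc : Continuous fun k => ‖(reg g N * F) k‖^2 := by fun_prop
    have := hc.measurable
    simpa only [e1] using this
  have c3 : Tendsto (fun N => ∫⁻ k, ENNReal.ofReal (G N k) ∂ν) atTop
      (𝓝 (∫⁻ k, ENNReal.ofReal (U.indicator (fun k => ‖evc p (coordK r k)‖^2) k) ∂ν)) := by
    refine lintegral_tendsto_of_tendsto_of_monotone (fun N => (hGm N).ennreal_ofReal.aemeasurable)
      (ae_of_all _ fun k => ?_) (ae_of_all _ fun k => ?_)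
    · intro N M hNM
      refine ENNReal.ofReal_le_ofReal ?_
      simp only [hG]
      by_cases hk : k ∈ U
      · simp only [Set.indicator_of_mem hk]
        gcongr
      · simp only [Set.indicator_of_notMem hk]; exact le_rfl
    · refine ENNReal.tendsto_ofReal ?_
      simp only [hG]
      by_cases hk : k ∈ U
      · simp only [Set.indicator_of_mem hk]
        have hgk0 : ‖g k‖^2 ≠ 0 := by
          have : g k ≠ 0 := by rw [hgk]; exact pow_ne_zero _ hk
          simpa using this
        have ht := tendsto_one_div_add_atTop_nhds_zero_nat (𝕜 := ℝ)
        have h6 : Tendsto (fun N : ℕ => (‖g k‖^2 / (‖g k‖^2 + (1/((N:ℝ)+1))^2))^2 * ‖evc p (coordK r k)‖^2)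
          atTop (𝓝 ((‖g k‖^2 / (‖g k‖^2 + 0^2))^2 * ‖evc p (coordK r k)‖^2)) := by
          refine Tendsto.mul_const _ (Tendsto.pow (Tendsto.div tendsto_const_nhds
            (tendsto_const_nhds.add (ht.pow 2)) ?_) 2)
          simpa using hgk0
        rw [zero_pow (by norm_num), add_zero, div_self hgk0, one_pow, one_mul] at h6
        exact h6
      · simp only [Set.indicator_of_notMem hk]; exact tendsto_const_nhds
  have := tendsto_nhds_unique c3 c2
  rw [← this, ← lintegral_indicator hUm]
  refine lintegral_congr fun k => ?_
  by_cases hk : k ∈ U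
  · simp only [Set.indicator_of_mem hk]
  · simp only [Set.indicator_of_notMem hk, ENNReal.ofReal_zero]

lemma rep_of_norm (φ : Measure (EuclideanSpace ℝ (Fin n)))
    (h : ∀ p : MvPolynomial (Fin n) ℂ, ∫⁻ x, ENNReal.ofReal (‖evc p x‖^2) ∂φ =
      ENNReal.ofReal (Lc y (cj p * p)).re) (hpos : ∀ a, 0 ≤ Lr y (a^2)) : Represents φ y := by
  have hre : ∀ (a : MvPolynomial (Fin n) ℝ) x, evc (rm a) x = ((pev a x : ℝ) : ℂ) := by
    intro a x
    induction a using MvPolynomial.induction_on with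
    | C a => simp [rm, evc, pev]
    | add p q hp hq => simp only [evc, pev, map_add] at *; rw [hp, hq]; push_cast; rfl
    | mul_X p i hp => simp only [evc, pev, map_mul] at *; rw [hp]; simp [rm]
  have hcont : ∀ a : MvPolynomial (Fin n) ℝ, Continuous (pev a) := by
    intro a
    have := Complex.continuous_re.comp (evc_cont (rm a))
    refine this.congr fun x => ?_
    simp [hre]
  have hsq : ∀ a : MvPolynomial (Fin n) ℝ, Integrable (fun x => (pev a x)^2) φ ∧
      ∫ x, (pev a x)^2 ∂φ = Lr y (a^2) := by
    intro a
    have h1 := h (rm a)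
    rw [cj_rm, ← map_mul, Lc_rm, Complex.ofReal_re, ← sq] at h1
    simp only [hre, Complex.norm_real, Real.norm_eq_abs, sq_abs] at h1
    have hm : AEStronglyMeasurable (fun x => (pev a x)^2) φ :=
      ((hcont a).pow 2).aestronglyMeasurable
    refine ⟨⟨hm, ?_⟩, ?_⟩
    · rw [hasFiniteIntegral_iff_ofReal (ae_of_all _ fun x => by positivity), h1]
      exact ENNReal.ofReal_lt_top
    · rw [integral_eq_lintegral_of_nonneg_ae (ae_of_all _ fun x => by positivity) hm, h1,
        ENNReal.toReal_ofReal (hpos a)]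
  intro α
  set b : MvPolynomial (Fin n) ℝ := monomial (Finsupp.equivFunOnFinite.symm α) 1 with hb
  have hbα : ∀ x, monom α x = pev b x := by
    intro x
    rw [hb, pev, eval_monomial, Finsupp.prod_fintype _ _ (by simp), monom]
    simp
  have hpol : ∀ x, monom α x = (1/4 : ℝ) * ((pev (b+1) x)^2 - (pev (b-1) x)^2) := by
    intro x
    rw [hbα]
    simp only [pev, map_add, map_sub, map_one]; ring
  have e : monom α = fun x => (1/4 : ℝ) * ((pev (b+1) x)^2 - (pev (b-1) x)^2) := funext hpol
  have hL : Lr y b = y α := by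
    rw [hb, Lr_monomial]; simp
  refine ⟨?_, ?_⟩
  · rw [e]
    exact ((hsq (b+1)).1.sub (hsq (b-1)).1).const_mul _
  · rw [e, integral_const_mul, integral_sub (hsq (b+1)).1 (hsq (b-1)).1, (hsq _).2, (hsq _).2,
      ← map_sub]
    have : (b+1)^2 - (b-1)^2 = (4:ℝ) • b := by
      rw [smul_eq_C_mul, show (C (4:ℝ) : MvPolynomial (Fin n) ℝ) = 4 from rfl]; ring
    rw [this, map_smul, hL, smul_eq_mul]; ring
end

theorem rep_exists {n : ℕ} {y : (Fin n → ℕ) → ℝ} (hpos : ∀ a, 0 ≤ Lr y (a^2)) (hd : Dens y) :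
    ∃ φ : Measure (EuclideanSpace ℝ (Fin n)), Represents φ y := by
  obtain ⟨H, _, _, _, ι, hdense, hι⟩ := exists_gns y hpos
  obtain ⟨T, hT1, hT2, hT3, hT4⟩ := exists_resolvents' hdense hι hd
  obtain ⟨K, _, _, _, Θ, r, hinj, hΘ⟩ := spec_calc T hT2 hT3
  let mK : MeasurableSpace K := borel K
  have bK : BorelSpace K := ⟨rfl⟩
  obtain ⟨ν, hfin, hν⟩ := spec_meas Θ (ι 1)
  have hr : ∀ j, r j - star (r j) = (2 * Complex.I) • (star (r j) * r j) := by
    intro j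
    apply hinj
    rw [map_sub, map_smul, map_mul, map_star, hΘ]
    exact hT4 j
  have hT : ∀ j q, Θ (r j) (ι (sg j Complex.I * q)) = ι q := by
    intro j q; rw [hΘ]; exact hT1 j q
  refine ⟨(ν.restrict {k | (∏ j, r j k) ≠ 0}).map (coordK r), rep_of_norm _ (fun p => ?_) hpos⟩
  rw [lintegral_map _ (coordK_meas r), calc_norm Θ r hr hT ν hν p, gns_norm hι]
  have := (evc_cont p).measurable
  fun_prop

/-- **multivariate Carleman condition.**  If all moment matrices `M_d(y)` are
positive semidefinite and `Σ_{k≥1} L_y(x_i^{2k})^{−1/(2k)} = +∞` for every `i`, then `y` has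
a representing Borel measure on `ℝⁿ` which is moment determinate. -/
theorem statement1 {n : ℕ} (y : (Fin n → ℕ) → ℝ)
    (hmom : ∀ d : ℕ, locPSD y 1 d)
    (hcarleman : ∀ i : Fin n,
      Tendsto (fun N : ℕ => ∑ k ∈ Finset.Icc 1 N,
          (riesz y ((X i : MvPolynomial (Fin n) ℝ) ^ (2 * k))) ^ (-(1 : ℝ) / (2 * (k : ℝ))))
        atTop atTop) :
    ∃ φ : Measure (EuclideanSpace ℝ (Fin n)),
      Represents φ y ∧
      ∀ ψ : Measure (EuclideanSpace ℝ (Fin n)), Represents ψ y → ψ = φ := by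
  have hpos : ∀ a, 0 ≤ Lr y (a ^ 2) := by
    intro a
    have := hmom a.totalDegree a le_rfl
    rwa [one_mul, riesz_eq] at this
  have hd : Dens y := dens_of_carleman y hpos hcarleman
  obtain ⟨φ, hφ⟩ := rep_exists hpos hd
  exact ⟨φ, hφ, fun ψ hψ => rep_unique hd hψ hφ⟩
end
end
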